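/- arXiv:1703.06262 — 2 statements merged into one kernel-verified Lean document; each statement's English description precedes it below -/
import Mathlib

section
/- (Two-dimensionality of global solutions.) Let u ∈ P_∞(M) with upper obstacle ψ(x) = (a/2)(x₁⁺)² in ℝⁿ, and assume there exists ε₀ > 0 such that δ_r(u) ≥ ε₀ for all r > 0. Then the interior of Λ(u) is nonempty (|Int Λ(u)| ≠ 0), and u is two-dimensional: in an appropriate orthonormal system of coordinates keeping the direction e₁, there is a function w : ℝ² → ℝ such that u(x) = w(x₁, x₂) for all x ∈ ℝⁿ, with ∂₂w ≥ 0. -/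
/- Setting: the double obstacle problem
   Δu = f·χ_{Ω(u)∩{u<ψ}} + Δψ·χ_{Ω(u)∩{u=ψ}},  u ≤ ψ,
   following "Regularity of the free boundary for the double obstacle problem". -/

open Set Metric MeasureTheory Filter
open scoped RealInnerProductSpace NNReal

noncomputable section

/-- Euclidean space `ℝⁿ`. -/
abbrev E (n : ℕ) := EuclideanSpace ℝ (Fin n)

variable {n : ℕ}

/-- Pointwise Laplacian, via iterated `fderiv` along the coordinate directions
(defined a.e. for `C^{1,1}` functions, junk value elsewhere). -/
def lap (u : E n → ℝ) (x : E n) : ℝ :=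
  ∑ i : Fin n, fderiv ℝ (fun y => fderiv ℝ u y (EuclideanSpace.single i 1)) x
    (EuclideanSpace.single i 1)

/-- `Λ(v) = {x ∈ D : v(x) = 0, ∇v(x) = 0}`. -/
def Lam (D : Set (E n)) (v : E n → ℝ) : Set (E n) :=
  {x ∈ D | v x = 0 ∧ gradient v x = 0}

/-- `Ω(v) = D \ Λ(v)`. -/
def Om (D : Set (E n)) (v : E n → ℝ) : Set (E n) := D \ Lam D v

/-- `Γ(v) = ∂Λ(v) ∩ D`. -/
def Gam (D : Set (E n)) (v : E n → ℝ) : Set (E n) := frontier (Lam D v) ∩ D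

/-- `Λ^ψ(u) = {x ∈ D : u(x) = ψ(x)}`. -/
def LamPsi (D : Set (E n)) (u ψ : E n → ℝ) : Set (E n) := {x ∈ D | u x = ψ x}

/-- `Γ^ψ(u) = ∂Λ^ψ(u) ∩ D`. -/
def GamPsi (D : Set (E n)) (u ψ : E n → ℝ) : Set (E n) := frontier (LamPsi D u ψ) ∩ D

/-- The unit ball `B₁`. -/
def B1 (n : ℕ) : Set (E n) := ball 0 1

/-- The class `P₁(M)`: `f ∈ C^{0,1}(B₁)`, `ψ ∈ C^{1,1}(B₁) ∩ C^{2,1}(closure Ω(ψ))`,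
`u ∈ C^{1,1}(B₁)` with `‖D²u‖_{L^∞(B₁)} ≤ M`, `u ≤ ψ` in `B₁`,
`Δu = f·χ_{Ω(u)∩{u<ψ}} + Δψ·χ_{Ω(u)∩{u=ψ}}` a.e. in `B₁`, and `0 ∈ Γ^d(u)`. -/
structure P1 (n : ℕ) (M : ℝ) (u ψ f : E n → ℝ) : Prop where
  f_lip : ∃ K : ℝ≥0, LipschitzOnWith K f (B1 n)
  psi_c1 : ContDiffOn ℝ 1 ψ (B1 n)
  psi_c11 : ∃ K : ℝ≥0, LipschitzOnWith K (fderiv ℝ ψ) (B1 n)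
  psi_c2 : ContDiffOn ℝ 2 ψ (Om (B1 n) ψ)
  psi_c21 : ∃ K : ℝ≥0, LipschitzOnWith K (fderiv ℝ (fderiv ℝ ψ)) (closure (Om (B1 n) ψ))
  u_c1 : ContDiffOn ℝ 1 u (B1 n)
  u_c11 : LipschitzOnWith (Real.toNNReal M) (fderiv ℝ u) (B1 n)
  u_le : ∀ x ∈ B1 n, u x ≤ ψ x
  u_eq : ∀ᵐ x : E n, x ∈ B1 n →
    lap u x = (Om (B1 n) u ∩ {y | u y < ψ y}).indicator f x
      + (Om (B1 n) u ∩ {y | u y = ψ y}).indicator (lap ψ) x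
  zero_mem : (0 : E n) ∈ Gam (B1 n) u ∩ GamPsi (B1 n) u ψ

/-- Minimal diameter: least distance between two parallel hyperplanes whose
enclosed slab contains `A`. -/
def MD (A : Set (E n)) : ℝ :=
  sInf {d : ℝ | 0 ≤ d ∧ ∃ (e : E n) (b : ℝ), ‖e‖ = 1 ∧
    ∀ x ∈ A, b ≤ ⟪x, e⟫ ∧ ⟪x, e⟫ ≤ b + d}

/-- Thickness `δ_r(v) = MD(Λ(v) ∩ B_r)/r` (centered at the origin). -/
def thick (D : Set (E n)) (v : E n → ℝ) (r : ℝ) : ℝ := MD (Lam D v ∩ ball (0 : E n) r) / r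

/-- The class `P_∞(M)` (with constant `a > 1`):
`Δu = χ_{Ω(u)∩{u<ψ}} + a·χ_{Ω(u)∩{u=ψ}}`, `u ≤ ψ`, `Δψ = a·χ_{Ω(ψ)}` a.e. in `ℝⁿ`,
`u, ψ ∈ C^{1,1}(ℝⁿ)` with `‖D²u‖_{L^∞} ≤ M`, and `0 ∈ Γ(u)`. -/
structure Pinf (n : ℕ) (M a : ℝ) (u ψ : E n → ℝ) : Prop where
  ha : 1 < a
  u_c1 : ContDiff ℝ 1 u
  u_c11 : LipschitzWith (Real.toNNReal M) (fderiv ℝ u)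
  psi_c1 : ContDiff ℝ 1 ψ
  psi_c11 : ∃ K : ℝ≥0, LipschitzWith K (fderiv ℝ ψ)
  u_le : ∀ x, u x ≤ ψ x
  u_eq : ∀ᵐ x : E n, lap u x =
    (Om univ u ∩ {y | u y < ψ y}).indicator (fun _ => (1 : ℝ)) x
      + (Om univ u ∩ {y | u y = ψ y}).indicator (fun _ => a) x
  psi_eq : ∀ᵐ x : E n, lap ψ x = (Om univ ψ).indicator (fun _ => a) x
  zero_mem : (0 : E n) ∈ frontier (Lam univ u)

lemma tp_hasDerivAt (j : ℕ) (x : ℝ) :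
    HasDerivAt (fun x : ℝ => max x 0 ^ (j + 2)) ((j + 2 : ℕ) * max x 0 ^ (j + 1)) x := by
  rcases lt_trichotomy x 0 with h | h | h
  · have : (fun x : ℝ => max x 0 ^ (j + 2)) =ᶠ[nhds x] fun _ => 0 := by
      filter_upwards [Iio_mem_nhds h] with y hy
      rw [max_eq_right (le_of_lt hy)]; simp
    rw [max_eq_right h.le]
    simpa using (hasDerivAt_const x (0 : ℝ)).congr_of_eventuallyEq this
  · subst h
    simp only [max_self, ne_eq, Nat.add_eq_zero_iff, one_ne_zero, and_false, not_false_eq_true,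
      zero_pow, mul_zero]
    rw [hasDerivAt_iff_isLittleO_nhds_zero]
    simp only [zero_add, max_self, ne_eq, Nat.add_eq_zero_iff, OfNat.ofNat_ne_zero, and_false,
      not_false_eq_true, zero_pow, sub_zero, smul_zero]
    have h1 : (fun h : ℝ => max h 0 ^ (j + 2)) =O[nhds 0] fun h : ℝ => h ^ (j + 2) := by
      refine Asymptotics.IsBigO.of_bound 1 (Eventually.of_forall fun h => ?_)
      rw [one_mul, norm_pow, norm_pow]
      gcongr
      rw [Real.norm_eq_abs, Real.norm_eq_abs]
      rcases le_total h 0 with h' | h' <;> simp [h']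
    refine h1.trans_isLittleO ?_
    have := Asymptotics.isLittleO_pow_pow (𝕜 := ℝ) (show 1 < j + 2 by omega)
    simpa using this
  · have : (fun x : ℝ => max x 0 ^ (j + 2)) =ᶠ[nhds x] fun x => x ^ (j + 2) := by
      filter_upwards [Ioi_mem_nhds h] with y hy
      rw [max_eq_left (le_of_lt hy)]
    rw [max_eq_left h.le]
    simpa using (hasDerivAt_pow (j + 2) x).congr_of_eventuallyEq this

/-- the averaging kernel -/
def rho (z : E n) : ℝ := max (1 - ‖z‖ ^ 2) 0 ^ 2

/-- its potential -/
def ker3 (z : E n) : ℝ := max (1 - ‖z‖ ^ 2) 0 ^ 3 / 6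

lemma rho_cont : Continuous (rho : E n → ℝ) := by unfold rho; fun_prop
lemma ker3_cont : Continuous (ker3 : E n → ℝ) := by unfold ker3; fun_prop
lemma rho_nonneg (z : E n) : 0 ≤ rho z := by unfold rho; positivity
lemma ker3_nonneg (z : E n) : 0 ≤ ker3 z := by unfold ker3; positivity
lemma rho_zero {z : E n} (h : 1 ≤ ‖z‖) : rho z = 0 := by
  unfold rho; rw [max_eq_right (by nlinarith)]; simp
lemma ker3_zero {z : E n} (h : 1 ≤ ‖z‖) : ker3 z = 0 := by
  unfold ker3; rw [max_eq_right (by nlinarith)]; simp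
lemma rho_cs : HasCompactSupport (rho : E n → ℝ) :=
  HasCompactSupport.intro (isCompact_closedBall 0 1) fun x hx => rho_zero (by
    simp only [mem_closedBall, dist_zero_right, not_le] at hx; exact hx.le)
lemma ker3_cs : HasCompactSupport (ker3 : E n → ℝ) :=
  HasCompactSupport.intro (isCompact_closedBall 0 1) fun x hx => ker3_zero (by
    simp only [mem_closedBall, dist_zero_right, not_le] at hx; exact hx.le)

lemma ker3_hasFDerivAt (z : E n) :
    HasFDerivAt ker3 (-(rho z) • innerSL ℝ z) z := by
  have h1 : HasFDerivAt (fun z : E n => 1 - ‖z‖ ^ 2) (-(2 • innerSL ℝ z)) z := by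
    simpa using (hasStrictFDerivAt_norm_sq z).hasFDerivAt.const_sub 1
  have h2 := ((tp_hasDerivAt 1 (1 - ‖z‖ ^ 2)).div_const 6).comp_hasFDerivAt z h1
  refine h2.congr_fderiv ?_
  ext y
  simp [rho]
  ring

lemma ker3_contDiff : ContDiff ℝ 1 (ker3 : E n → ℝ) := by
  rw [contDiff_one_iff_fderiv]
  refine ⟨fun z => (ker3_hasFDerivAt z).differentiableAt, ?_⟩
  have : fderiv ℝ (ker3 : E n → ℝ) = fun z => -(rho z) • innerSL ℝ z := by
    ext1 z; exact (ker3_hasFDerivAt z).fderiv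
  rw [this]
  exact (rho_cont.neg).smul (innerSL ℝ).continuous

lemma ker3_lip : ∃ D, LipschitzWith D (ker3 : E n → ℝ) :=
  ContDiff.lipschitzWith_of_hasCompactSupport ker3_cs ker3_contDiff (by simp)

/-- the partial derivative. -/
abbrev pd (w : E n → ℝ) (i : Fin n) (x : E n) : ℝ := fderiv ℝ w x (EuclideanSpace.single i 1)

lemma norm_single_one (i : Fin n) : ‖(EuclideanSpace.single i 1 : E n)‖ = 1 := by simp

lemma pd_lip {w : E n → ℝ} {K : ℝ≥0} (hw : LipschitzWith K (fderiv ℝ w)) (i : Fin n) :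
    LipschitzWith K (pd w i) := by
  refine LipschitzWith.of_dist_le_mul fun x y => ?_
  have h := hw.dist_le_mul x y
  rw [dist_eq_norm] at h ⊢
  calc ‖pd w i x - pd w i y‖ = ‖(fderiv ℝ w x - fderiv ℝ w y) (EuclideanSpace.single i 1)‖ := by
        simp [pd]
    _ ≤ ‖fderiv ℝ w x - fderiv ℝ w y‖ * ‖(EuclideanSpace.single i 1 : E n)‖ :=
        ContinuousLinearMap.le_opNorm _ _
    _ ≤ _ := by rw [norm_single_one, mul_one]; exact h

lemma lap_meas (w : E n → ℝ) : Measurable (lap w) := by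
  unfold lap
  exact Finset.measurable_sum _ fun i _ => measurable_fderiv_apply_const ℝ _ _

lemma pd2_bound {w : E n → ℝ} {K : ℝ≥0} (hw : LipschitzWith K (fderiv ℝ w)) (i : Fin n) (x : E n) :
    |fderiv ℝ (pd w i) x (EuclideanSpace.single i 1)| ≤ K := by
  have := ContinuousLinearMap.le_opNorm (fderiv ℝ (pd w i) x) (EuclideanSpace.single i 1)
  rw [norm_single_one, mul_one] at this
  exact this.trans (norm_fderiv_le_of_lipschitz ℝ (pd_lip hw i))

lemma lap_bound {w : E n → ℝ} {K : ℝ≥0} (hw : LipschitzWith K (fderiv ℝ w)) (x : E n) :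
    |lap w x| ≤ n * K := by
  unfold lap
  refine (Finset.abs_sum_le_sum_abs _ _).trans ?_
  refine (Finset.sum_le_sum fun i _ => pd2_bound hw i x).trans ?_
  simp

lemma pd_diff_ae {w : E n → ℝ} {K : ℝ≥0} (hw : LipschitzWith K (fderiv ℝ w)) :
    ∀ᵐ x : E n, ∀ i, DifferentiableAt ℝ (pd w i) x :=
  ae_all_iff.2 fun i => (pd_lip hw i).ae_differentiableAt

lemma ibp {w : E n → ℝ} {K : ℝ≥0} (hw : LipschitzWith K (fderiv ℝ w)) :
    ∫ x, lap w x * ker3 x = ∫ x, fderiv ℝ w x x * rho x := by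
  obtain ⟨D, hD⟩ := (ker3_lip : ∃ D, LipschitzWith D (ker3 : E n → ℝ))
  have hwc : Continuous (fderiv ℝ w) := hw.continuous
  have key : ∀ i, ∫ x, fderiv ℝ (pd w i) x (EuclideanSpace.single i 1) * ker3 x =
      ∫ x, pd w i x * x i * rho x := by
    intro i
    have h := LipschitzWith.integral_lineDeriv_mul_eq (μ := (volume : Measure (E n)))
      (pd_lip hw i) hD ker3_cs (EuclideanSpace.single i 1)
    calc _ = ∫ x, lineDeriv ℝ (pd w i) x (EuclideanSpace.single i 1) * ker3 x := by
          apply integral_congr_ae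
          filter_upwards [(pd_lip hw i).ae_differentiableAt (μ := volume)] with x hx
          rw [hx.lineDeriv_eq_fderiv]
      _ = _ := h
      _ = _ := by
          congr 1; ext x
          rw [(ker3_hasFDerivAt x).differentiableAt.lineDeriv_eq_fderiv,
            (ker3_hasFDerivAt x).fderiv]
          simp [EuclideanSpace.inner_single_right]
          ring
  have hIntg : ∀ i, Integrable fun x => fderiv ℝ (pd w i) x (EuclideanSpace.single i 1) * ker3 x := by
    intro i
    refine (ker3_cont.integrable_of_hasCompactSupport ker3_cs).bdd_mul (c := K)
      (measurable_fderiv_apply_const ℝ _ _).aestronglyMeasurable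
      (Eventually.of_forall fun x => pd2_bound hw i x)
  have hIntg2 : ∀ i, Integrable fun x : E n => pd w i x * x i * rho x := by
    intro i
    refine Continuous.integrable_of_hasCompactSupport ?_ ?_
    · have := rho_cont (n := n); unfold pd; fun_prop
    · exact rho_cs.mul_left
  calc _ = ∫ x, ∑ i, fderiv ℝ (pd w i) x (EuclideanSpace.single i 1) * ker3 x := by
        simp only [lap, Finset.sum_mul]
    _ = ∑ i, ∫ x, fderiv ℝ (pd w i) x (EuclideanSpace.single i 1) * ker3 x :=
        integral_finsetSum _ fun i _ => hIntg i
    _ = ∑ i, ∫ x, pd w i x * x i * rho x := Finset.sum_congr rfl fun i _ => key i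
    _ = ∫ x, ∑ i, pd w i x * x i * rho x := (integral_finsetSum _ fun i _ => hIntg2 i).symm
    _ = _ := by
      congr 1; ext x
      rw [← Finset.sum_mul]
      congr 1
      have hx := congrArg (fderiv ℝ w x) ((EuclideanSpace.basisFun (Fin n) ℝ).sum_repr x)
      rw [← hx]
      simp [pd, mul_comm]


/-- weighted averages -/
def avg (w : E n → ℝ) (p : E n) (s : ℝ) : ℝ := ∫ z, w (p + s • z) * rho z

lemma fderiv_scale (w : E n → ℝ) (p : E n) (s : ℝ) (z : E n) :
    fderiv ℝ (fun z => w (p + s • z)) z = s • fderiv ℝ w (p + s • z) := by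
  have h := fderiv_comp_smul (𝕜 := ℝ) (f := fun y => w (p + y)) (x := z) s
  rw [h, fderiv_comp_add_left]

lemma lap_scale (w : E n → ℝ) (p : E n) (s : ℝ) (z : E n) :
    lap (fun z => w (p + s • z)) z = s ^ 2 * lap w (p + s • z) := by
  unfold lap
  rw [Finset.mul_sum]
  refine Finset.sum_congr rfl fun i _ => ?_
  have : (fun y => fderiv ℝ (fun z => w (p + s • z)) y (EuclideanSpace.single i 1)) =
      s • fun y => (fun x => pd w i x) (p + s • y) := by
    ext y; rw [fderiv_scale]; simp
  rw [this, fderiv_const_smul_field, Pi.smul_apply, fderiv_scale (fun x => pd w i x)]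
  simp [pd]; ring

lemma lip_scale {w : E n → ℝ} {K : ℝ≥0} (hw : LipschitzWith K (fderiv ℝ w)) (p : E n) (s : ℝ) :
    ∃ K', LipschitzWith K' (fderiv ℝ (fun z => w (p + s • z))) := by
  refine ⟨‖s‖₊ * (K * ‖s‖₊), LipschitzWith.of_dist_le_mul fun x y => ?_⟩
  rw [fderiv_scale, fderiv_scale, dist_eq_norm, ← smul_sub, norm_smul, ← dist_eq_norm]
  have := hw.dist_le_mul (p + s • x) (p + s • y)
  rw [dist_add_left, dist_smul₀] at this
  push_cast
  calc _ ≤ ‖s‖ * (K * (‖s‖ * dist x y)) := by gcongr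
    _ = _ := by simp; ring

lemma avg_hasDerivAt {w : E n → ℝ} {K : ℝ≥0} (hc : ContDiff ℝ 1 w)
    (hw : LipschitzWith K (fderiv ℝ w)) (p : E n) (s : ℝ) :
    HasDerivAt (avg w p) (∫ z, fderiv ℝ w (p + s • z) z * rho z) s := by
  have hwc : Continuous (fderiv ℝ w) := hw.continuous
  have hcc : Continuous w := hc.continuous
  have hr := rho_cont (n := n)
  have hd : Differentiable ℝ w := hc.differentiable (by simp)
  have := hasDerivAt_integral_of_dominated_loc_of_deriv_le (μ := (volume : Measure (E n)))
    (F := fun s z => w (p + s • z) * rho z) (F' := fun s z => fderiv ℝ w (p + s • z) z * rho z)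
    (x₀ := s) (s := ball s 1)
    (bound := fun z => (‖fderiv ℝ w p‖ + K * ((|s| + 1) * ‖z‖)) * ‖z‖ * rho z)
    (ball_mem_nhds s one_pos) ?_ ?_ ?_ ?_ ?_ ?_
  · exact this.2
  · exact Eventually.of_forall fun x => (by fun_prop : Continuous _).aestronglyMeasurable
  · exact (by fun_prop : Continuous _).integrable_of_hasCompactSupport rho_cs.mul_left
  · exact (by fun_prop : Continuous _).aestronglyMeasurable
  · refine Eventually.of_forall fun z x hx => ?_
    rw [norm_mul, Real.norm_of_nonneg (rho_nonneg z)]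
    gcongr
    · exact rho_nonneg z
    refine (ContinuousLinearMap.le_opNorm _ _).trans ?_
    gcongr
    have h1 := hw.dist_le_mul (p + x • z) p
    rw [dist_eq_norm, dist_eq_norm, add_sub_cancel_left, norm_smul] at h1
    have h2 : ‖x‖ ≤ |s| + 1 := by
      rw [mem_ball, Real.dist_eq] at hx
      rw [Real.norm_eq_abs]
      have := abs_sub_abs_le_abs_sub x s
      linarith
    calc ‖fderiv ℝ w (p + x • z)‖ ≤ ‖fderiv ℝ w p‖ + ‖fderiv ℝ w (p + x • z) - fderiv ℝ w p‖ := by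
          have := norm_add_le (fderiv ℝ w p) (fderiv ℝ w (p + x • z) - fderiv ℝ w p)
          simpa using this
      _ ≤ _ := by
          gcongr
          refine h1.trans ?_
          gcongr
  · exact (by fun_prop : Continuous _).integrable_of_hasCompactSupport rho_cs.mul_left
  · refine Eventually.of_forall fun z x hx => ?_
    have h1 : HasDerivAt (fun x : ℝ => p + x • z) z x := by
      simpa using ((hasDerivAt_id x).smul_const z).const_add p
    exact ((hd (p + x • z)).hasFDerivAt.comp_hasDerivAt x h1).mul_const (rho z)

lemma avg_deriv_eq {w : E n → ℝ} {K : ℝ≥0}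
    (hw : LipschitzWith K (fderiv ℝ w)) (p : E n) {s : ℝ} (hs : 0 < s) :
    ∫ z, fderiv ℝ w (p + s • z) z * rho z = s * ∫ z, lap w (p + s • z) * ker3 z := by
  obtain ⟨K', hK'⟩ := lip_scale hw p s
  have h := ibp hK'
  simp_rw [lap_scale, fderiv_scale] at h
  simp only [smul_apply, smul_eq_mul, mul_assoc, integral_const_mul] at h
  have h2 : s * (s * ∫ z, lap w (p + s • z) * ker3 z) =
    s * ∫ z, fderiv ℝ w (p + s • z) z * rho z := by
    rw [← h]; ring
  exact (mul_left_cancel₀ hs.ne' h2).symm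

/-- total mass of the kernel -/
def c0 (n : ℕ) : ℝ := ∫ z : E n, rho z

lemma c0_pos : 0 < c0 n := by
  refine (rho_cont.integral_pos_of_hasCompactSupport_nonneg_nonzero rho_cs rho_nonneg
    (x := 0) ?_)
  simp [rho]

lemma avg_zero (w : E n → ℝ) (p : E n) : avg w p 0 = w p * c0 n := by
  simp [avg, c0, integral_const_mul]

lemma ae_scale {P : E n → Prop} (h : ∀ᵐ x, P x) (p : E n) {s : ℝ} (hs : 0 < s) :
    ∀ᵐ z : E n, P (p + s • z) := by
  have h1 := (measurePreserving_add_left (volume : Measure (E n)) p).quasiMeasurePreserving.ae h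
  exact (Measure.quasiMeasurePreserving_smul (volume : Measure (E n)) hs.ne').ae h1

/-- The sub-mean value property. -/
lemma mvp {w : E n → ℝ} {K : ℝ≥0} (hc : ContDiff ℝ 1 w)
    (hw : LipschitzWith K (fderiv ℝ w)) (p : E n) {R : ℝ} (hR : 0 < R)
    (h : ∀ᵐ x : E n, x ∈ ball p R → 0 ≤ lap w x) :
    w p * c0 n ≤ avg w p R := by
  rw [← avg_zero]
  have hm : MonotoneOn (avg w p) (Icc 0 R) := by
    refine monotoneOn_of_deriv_nonneg (convex_Icc 0 R)
      (fun s _ => (avg_hasDerivAt hc hw p s).continuousAt.continuousWithinAt)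
      (fun s _ => (avg_hasDerivAt hc hw p s).differentiableAt.differentiableWithinAt) ?_
    intro s hs
    rw [interior_Icc] at hs
    rw [(avg_hasDerivAt hc hw p s).deriv, avg_deriv_eq hw p hs.1]
    refine mul_nonneg hs.1.le (integral_nonneg_of_ae ?_)
    filter_upwards [ae_scale h p hs.1] with z hz
    by_cases h1 : 1 ≤ ‖z‖
    · simp [ker3_zero h1]
    · refine mul_nonneg (hz ?_) (ker3_nonneg z)
      rw [mem_ball, dist_eq_norm, add_sub_cancel_left, norm_smul, Real.norm_of_nonneg hs.1.le]
      nlinarith [hs.1, hs.2, norm_nonneg z]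
  exact hm (left_mem_Icc.2 hR.le) (right_mem_Icc.2 hR.le) hR.le

/-- Strong maximum principle, local form. -/
lemma smp {w : E n → ℝ} {K : ℝ≥0} (hc : ContDiff ℝ 1 w)
    (hw : LipschitzWith K (fderiv ℝ w)) (p : E n) {R : ℝ} (hR : 0 < R)
    (h : ∀ᵐ x : E n, x ∈ ball p R → 0 ≤ lap w x) (hmax : ∀ x ∈ ball p R, w x ≤ w p) :
    ∀ x ∈ ball p R, w x = w p := by
  have hcc : Continuous w := hc.continuous
  have hr := rho_cont (n := n)
  by_contra hcon
  push Not at hcon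
  obtain ⟨x, hx, hne⟩ := hcon
  have hlt : w x < w p := lt_of_le_of_ne (hmax x hx) hne
  have h1 := mvp hc hw p hR h
  have h2 : 0 < ∫ z, (w p - w (p + R • z)) * rho z := by
    refine Continuous.integral_pos_of_hasCompactSupport_nonneg_nonzero (x := R⁻¹ • (x - p))
      (by fun_prop) rho_cs.mul_left ?_ ?_
    · intro z
      by_cases hz : 1 ≤ ‖z‖
      · simp [rho_zero hz]
      · refine mul_nonneg (sub_nonneg.2 (hmax _ ?_)) (rho_nonneg z)
        rw [mem_ball, dist_eq_norm, add_sub_cancel_left, norm_smul, Real.norm_of_nonneg hR.le]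
        nlinarith [norm_nonneg z]
    · rw [smul_inv_smul₀ hR.ne']
      have hz : ‖R⁻¹ • (x - p)‖ < 1 := by
        rw [norm_smul, norm_inv, Real.norm_of_nonneg hR.le, inv_mul_lt_one₀ hR, ← dist_eq_norm]
        exact hx
      have : 0 < rho (R⁻¹ • (x - p)) := by
        unfold rho
        have : 0 < 1 - ‖R⁻¹ • (x - p)‖ ^ 2 := by nlinarith [norm_nonneg (R⁻¹ • (x - p))]
        positivity
      simp only [add_sub_cancel]
      exact (mul_pos (by linarith) this).ne'
  have h3 : ∫ z, (w p - w (p + R • z)) * rho z = w p * c0 n - avg w p R := by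
    simp_rw [sub_mul]
    rw [integral_sub, integral_const_mul]
    · rfl
    · exact ((by fun_prop : Continuous _).integrable_of_hasCompactSupport rho_cs.mul_left)
    · exact ((by fun_prop : Continuous _).integrable_of_hasCompactSupport rho_cs.mul_left)
  linarith


/-- reflection of a point in the hyperplane `x₀ = 0` -/
def sg (p : E (n + 2)) : E (n + 2) := p - (2 * p 0) • EuclideanSpace.single 0 1

lemma sg_zero (p : E (n + 2)) : sg p 0 = -p 0 := by simp [sg]; ring

lemma sg_smul (c : ℝ) (p : E (n + 2)) : c • sg p = sg (c • p) := by
  simp only [sg, smul_sub, smul_smul, PiLp.smul_apply, smul_eq_mul]; ring_nf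

lemma norm_sub_sg (z q : E (n + 2)) : ‖z - sg q‖ ^ 2 = ‖z - q‖ ^ 2 + 4 * (z 0 * q 0) := by
  have : z - sg q = (z - q) + (2 * q 0) • EuclideanSpace.single 0 1 := by simp [sg]; abel
  rw [this, norm_add_sq_real, norm_smul, norm_single_one, real_inner_smul_right,
    EuclideanSpace.inner_single_right]
  simp only [Real.norm_eq_abs, mul_one, sq_abs]
  simp
  ring

lemma norm_sg (p : E (n + 2)) : ‖sg p‖ = ‖p‖ := by
  have := norm_sub_sg 0 p
  simpa using this

lemma rho_sg_le {z q : E (n + 2)} (h : 0 ≤ z 0 * q 0) : rho (z - sg q) ≤ rho (z - q) := by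
  unfold rho
  rw [norm_sub_sg]
  gcongr
  linarith

lemma ker3_sg_le {z q : E (n + 2)} (h : 0 ≤ z 0 * q 0) : ker3 (z - sg q) ≤ ker3 (z - q) := by
  unfold ker3
  rw [norm_sub_sg]
  gcongr
  linarith

/-- nonnegative subharmonic functions vanishing on a half space -/
structure Good (k : E (n + 2) → ℝ) : Prop where
  cd : ContDiff ℝ 1 k
  lip : ∃ C, LipschitzWith C k
  dlip : ∃ K, LipschitzWith K (fderiv ℝ k)
  nonneg : ∀ x, 0 ≤ k x
  zero : ∀ x : E (n + 2), x 0 ≤ 0 → k x = 0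
  sub : ∀ᵐ x, 0 ≤ lap k x

lemma lap_congr {f g : E n → ℝ} {x : E n} (h : f =ᶠ[nhds x] g) : lap f x = lap g x := by
  unfold lap
  refine Finset.sum_congr rfl fun i _ => ?_
  have : (fun y => fderiv ℝ f y (EuclideanSpace.single i 1)) =ᶠ[nhds x]
      fun y => fderiv ℝ g y (EuclideanSpace.single i 1) := by
    filter_upwards [h.eventuallyEq_nhds] with y hy
    rw [hy.fderiv_eq]
  rw [this.fderiv_eq]

lemma coord_cont (i : Fin n) : Continuous fun x : E n => x i := by fun_prop

lemma Good.lap_zero {k : E (n + 2) → ℝ} (hk : Good k) {x : E (n + 2)} (hx : x 0 < 0) :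
    lap k x = 0 := by
  have : k =ᶠ[nhds x] fun _ => 0 := by
    filter_upwards [(isOpen_lt (coord_cont 0) continuous_const).mem_nhds hx] with y hy
    exact hk.zero y (le_of_lt hy)
  rw [lap_congr this]
  simp [lap]

lemma shift_int (F κ : E n → ℝ) (p : E n) {s : ℝ} (hs : 0 < s) :
    ∫ z, F (p + s • z) * κ z = ∫ z, F (s • z) * κ (z - s⁻¹ • p) := by
  rw [← integral_sub_right_eq_self (fun z => F (p + s • z) * κ z) (s⁻¹ • p)]
  congr 1; ext z
  rw [smul_sub, smul_inv_smul₀ hs.ne']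
  simp

/-- The half-space average. -/
def hav (k : E (n + 2) → ℝ) (p : E (n + 2)) (R : ℝ) : ℝ := avg k p R - avg k (sg p) R

lemma Good.hav_ge {k : E (n + 2) → ℝ} (hk : Good k) {p : E (n + 2)} (hp : 0 < p 0) {R : ℝ}
    (hR : 0 < R) : k p * c0 (n + 2) ≤ hav k p R := by
  obtain ⟨K, hw⟩ := hk.dlip
  have hc := hk.cd
  have h0 : k p * c0 (n + 2) = hav k p 0 := by
    rw [hav, avg_zero, avg_zero, hk.zero (sg p) (by rw [sg_zero]; linarith)]; ring
  rw [h0]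
  have hder : ∀ s, HasDerivAt (hav k p) _ s := fun s =>
    (avg_hasDerivAt hc hw p s).sub (avg_hasDerivAt hc hw (sg p) s)
  have hm : MonotoneOn (hav k p) (Icc 0 R) := by
    refine monotoneOn_of_deriv_nonneg (convex_Icc 0 R)
      (fun s _ => (hder s).continuousAt.continuousWithinAt)
      (fun s _ => (hder s).differentiableAt.differentiableWithinAt) ?_
    intro s hs
    rw [interior_Icc] at hs
    rw [(hder s).deriv, avg_deriv_eq hw p hs.1, avg_deriv_eq hw _ hs.1, ← mul_sub,
      shift_int _ _ _ hs.1, shift_int _ _ _ hs.1, ← integral_sub]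
    · refine mul_nonneg hs.1.le (integral_nonneg_of_ae ?_)
      filter_upwards [ae_scale hk.sub 0 hs.1] with z hz
      rw [zero_add] at hz
      simp only [Pi.zero_apply, ← mul_sub]
      rcases lt_or_ge (z 0) 0 with h | h
      · rw [hk.lap_zero (by simpa using mul_neg_of_pos_of_neg hs.1 h)]; simp
      · refine mul_nonneg hz (sub_nonneg.2 ?_)
        rw [sg_smul]
        refine ker3_sg_le (mul_nonneg h ?_)
        have := inv_pos.2 hs.1
        simp only [PiLp.smul_apply, smul_eq_mul]; positivity
    all_goals
      refine ((ker3_cont.integrable_of_hasCompactSupport ker3_cs).comp_sub_right _).bdd_mul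
        (c := (n + 2 : ℕ) * K)
        ((lap_meas k).comp (measurable_const_smul s)).aestronglyMeasurable
        (Eventually.of_forall fun x => lap_bound hw _)
  exact hm (left_mem_Icc.2 hR.le) (right_mem_Icc.2 hR.le) hR.le

lemma Good.le_lin {k : E (n + 2) → ℝ} {C : ℝ≥0} (hk : Good k) (hC : LipschitzWith C k)
    (x : E (n + 2)) : k x ≤ C * max (x 0) 0 := by
  rcases le_total (x 0) 0 with h | h
  · rw [hk.zero x h]; positivity
  · rw [max_eq_left h]
    have h1 := hC.dist_le_mul x (x - x 0 • EuclideanSpace.single 0 1)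
    rw [hk.zero (x - x 0 • EuclideanSpace.single 0 1) (by simp), dist_eq_norm, dist_eq_norm,
      sub_sub_cancel, norm_smul, norm_single_one, mul_one, sub_zero, Real.norm_of_nonneg h] at h1
    exact (le_abs_self _).trans h1

lemma Good.exists_sup {k : E (n + 2) → ℝ} (hk : Good k) (hne : ∃ x, k x ≠ 0) :
    ∃ A : ℝ, 0 < A ∧ (∀ x, k x ≤ A * max (x 0) 0) ∧ ∃ p, 0 < p 0 ∧ 3 / 4 * A * p 0 < k p := by
  obtain ⟨C, hC⟩ := hk.lip
  obtain ⟨x, hx⟩ := hne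
  have hx0 : 0 < x 0 := by
    by_contra h; exact hx (hk.zero x (not_lt.1 h))
  have hkx : 0 < k x := lt_of_le_of_ne (hk.nonneg x) hx.symm
  set S : Set ℝ := {t | ∃ x : E (n + 2), 0 < x 0 ∧ t = k x / x 0} with hS
  have hb : BddAbove S := by
    refine ⟨C, ?_⟩
    rintro t ⟨y, hy, rfl⟩
    rw [div_le_iff₀ hy]
    have := hk.le_lin hC y
    rwa [max_eq_left hy.le] at this
  have hA : 0 < sSup S := lt_of_lt_of_le (div_pos hkx hx0) (le_csSup hb ⟨x, hx0, rfl⟩)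
  refine ⟨sSup S, hA, ?_, ?_⟩
  · intro y
    rcases le_or_gt (y 0) 0 with h | h
    · rw [hk.zero y h]; positivity
    · rw [max_eq_left h.le, ← div_le_iff₀ h]
      exact le_csSup hb ⟨y, h, rfl⟩
  · obtain ⟨t, ⟨p, hp, rfl⟩, ht⟩ := exists_lt_of_lt_csSup (s := S) ⟨_, x, hx0, rfl⟩
      (show 3 / 4 * sSup S < sSup S by linarith)
    exact ⟨p, hp, by rwa [lt_div_iff₀ hp] at ht⟩

lemma hav_eq {k : E (n + 2) → ℝ} (hk : Continuous k) (p : E (n + 2)) {R : ℝ} (hR : 0 < R) :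
    hav k p R = ∫ z, k (R • z) * (rho (z - R⁻¹ • p) - rho (z - sg (R⁻¹ • p))) := by
  have hr := rho_cont (n := n + 2)
  rw [hav, avg, avg, shift_int _ _ _ hR, shift_int _ _ _ hR, ← integral_sub, ← sg_smul]
  · simp_rw [mul_sub]
  all_goals
    refine Continuous.integrable_of_hasCompactSupport (by fun_prop) ?_
    exact (rho_cs.comp_homeomorph (Homeomorph.subRight _)).mul_left

lemma hav_int {k : E (n + 2) → ℝ} (hk : Continuous k) (q : E (n + 2)) (R : ℝ) :
    Integrable fun z => k (R • z) * (rho (z - q) - rho (z - sg q)) := by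
  have hr := rho_cont (n := n + 2)
  refine Continuous.integrable_of_hasCompactSupport (by fun_prop) ?_
  exact ((rho_cs.comp_homeomorph (Homeomorph.subRight _)).sub
    (rho_cs.comp_homeomorph (Homeomorph.subRight _))).mul_left

lemma hav_lin (p : E (n + 2)) (R : ℝ) :
    hav (fun x : E (n + 2) => max (x 0) 0) p R = p 0 * c0 (n + 2) := by
  have hr := rho_cont (n := n + 2)
  have hIntg : ∀ f : E (n + 2) → ℝ, Continuous f → Integrable fun z => f z * rho z := fun f hf =>
    Continuous.integrable_of_hasCompactSupport (by fun_prop) rho_cs.mul_left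
  have h1 : avg (fun x : E (n + 2) => max (x 0) 0) (sg p) R =
      ∫ z : E (n + 2), max (-(p 0 + R * z 0)) 0 * rho z := by
    rw [avg, ← integral_neg_eq_self]
    congr 1; ext z
    have : rho (-z) = rho z := by simp [rho]
    rw [this]
    simp [sg_zero]
    left; ring_nf
  have h2 : avg (fun x : E (n + 2) => max (x 0) 0) p R = ∫ z : E (n + 2), max (p 0 + R * z 0) 0 * rho z := by
    simp [avg]
  have h3 : hav (fun x : E (n + 2) => max (x 0) 0) p R = ∫ z : E (n + 2), (p 0 + R * z 0) * rho z := by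
    rw [hav, h1, h2, ← integral_sub (hIntg _ (by fun_prop)) (hIntg _ (by fun_prop))]
    congr 1; ext z
    rw [← sub_mul]
    congr 1
    rcases le_total (p 0 + R * z 0) 0 with h | h
    · rw [max_eq_right h, max_eq_left (by linarith)]; ring
    · rw [max_eq_left h, max_eq_right (by linarith)]; ring
  have h4 : ∫ z : E (n + 2), (p 0 + R * z 0) * rho z = ∫ z : E (n + 2), (p 0 - R * z 0) * rho z := by
    rw [← integral_neg_eq_self]
    congr 1; ext z
    have : rho (-z) = rho z := by simp [rho]
    rw [this]
    simp
    left; ring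
  have h5 : ∫ z : E (n + 2), (p 0 + R * z 0) * rho z + (p 0 - R * z 0) * rho z =
      2 * (p 0 * c0 (n + 2)) := by
    rw [c0, ← integral_const_mul, ← integral_const_mul]
    congr 1; ext z; ring
  rw [integral_add (hIntg _ (by fun_prop)) (hIntg _ (by fun_prop)), ← h4] at h5
  rw [h3]; linarith

lemma hav_le {k : E (n + 2) → ℝ} (hc : Continuous k) (hz : ∀ x : E (n + 2), x 0 ≤ 0 → k x = 0)
    (hle : ∀ x, k x ≤ max (x 0) 0) {p : E (n + 2)} (hp : 0 < p 0) {R : ℝ} (hR : 0 < R) :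
    hav k p R ≤ p 0 * c0 (n + 2) := by
  rw [← hav_lin p R, hav_eq hc p hR, hav_eq (by fun_prop) p hR]
  refine integral_mono (hav_int hc _ _) (hav_int (k := fun x : E (n + 2) => max (x 0) 0) (by fun_prop) _ _) ?_
  intro z
  rcases le_or_gt (z 0) 0 with h | h
  · have h1 : (R • z) 0 ≤ 0 := by
      simpa using mul_nonpos_of_nonneg_of_nonpos hR.le h
    simp only [hz _ h1, max_eq_right h1, zero_mul, le_refl]
  · refine mul_le_mul_of_nonneg_right (hle _) (sub_nonneg.2 (rho_sg_le ?_))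
    have := inv_pos.2 hR
    simp only [PiLp.smul_apply, smul_eq_mul]; positivity

lemma real_ineq (x y : ℝ) :
    |max x 0 ^ 2 - max y 0 ^ 2 - 2 * max x 0 * (x - y)| ≤ (x - y) ^ 2 := by
  rw [abs_le]
  rcases le_total x 0 with hx | hx <;> rcases le_total y 0 with hy | hy <;>
    simp only [hx, hy, max_eq_left, max_eq_right] <;> constructor <;> nlinarith

lemma coord_le_norm (z : E n) (i : Fin n) : |z i| ≤ ‖z‖ := by
  simpa using PiLp.norm_apply_le z i


lemma ker_diff {p z : E (n + 2)} (hp : 0 < p 0) {τ : ℝ} (hτ : 0 < τ) (hτ1 : τ ≤ 1)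
    (hz : ‖z‖ ≤ 2) :
    |(rho (z - τ • p) - rho (z - sg (τ • p))) - τ * p 0 * (8 * z 0 * max (1 - ‖z‖ ^ 2) 0)| ≤
      τ * p 0 * (τ * (128 * ‖p‖ + 16 * ‖p‖ ^ 2)) := by
  have h0 : |p 0| ≤ ‖p‖ := coord_le_norm p 0
  have hz0 : |z 0| ≤ 2 := (coord_le_norm z 0).trans hz
  rw [abs_of_pos hp] at h0
  have e1 := norm_sub_sg z (τ • p)
  simp only [PiLp.smul_apply, smul_eq_mul] at e1
  have h1 := real_ineq (1 - ‖z - τ • p‖ ^ 2) (1 - ‖z - sg (τ • p)‖ ^ 2)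
  have e2 : (1 - ‖z - τ • p‖ ^ 2) - (1 - ‖z - sg (τ • p)‖ ^ 2) = 4 * (z 0 * (τ * p 0)) := by
    rw [e1]; ring
  rw [e2] at h1
  have h2 : |max (1 - ‖z - τ • p‖ ^ 2) 0 - max (1 - ‖z‖ ^ 2) 0| ≤ τ * (4 * ‖p‖ + ‖p‖ ^ 2) := by
    refine (abs_max_sub_max_le_abs _ _ _).trans ?_
    have e3 : ‖z - τ • p‖ ^ 2 = ‖z‖ ^ 2 - 2 * (τ * ⟪z, p⟫) + τ ^ 2 * ‖p‖ ^ 2 := by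
      rw [norm_sub_sq_real, real_inner_smul_right, norm_smul, Real.norm_of_nonneg hτ.le]; ring
    have e4 : |⟪z, p⟫| ≤ 2 * ‖p‖ := (abs_real_inner_le_norm z p).trans (by gcongr)
    rw [e3]
    have e5 := abs_le.1 e4
    have e6 : τ ^ 2 * ‖p‖ ^ 2 ≤ τ * ‖p‖ ^ 2 := by gcongr; nlinarith
    have e7 : 0 ≤ τ ^ 2 * ‖p‖ ^ 2 := by positivity
    have e8 : 0 ≤ τ * ‖p‖ ^ 2 := by positivity
    rw [abs_le]
    constructor <;> nlinarith
  set m1 := max (1 - ‖z - τ • p‖ ^ 2) 0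
  set m := max (1 - ‖z‖ ^ 2) 0
  have e9 : (rho (z - τ • p) - rho (z - sg (τ • p))) - τ * p 0 * (8 * z 0 * m) =
      (m1 ^ 2 - max (1 - ‖z - sg (τ • p)‖ ^ 2) 0 ^ 2 - 2 * m1 * (4 * (z 0 * (τ * p 0)))) +
        τ * p 0 * (8 * z 0 * (m1 - m)) := by
    simp only [rho, m1, m]; ring
  rw [e9]
  refine (abs_add_le _ _).trans ?_
  have t1 : (4 * (z 0 * (τ * p 0))) ^ 2 ≤ τ * p 0 * (τ * (64 * ‖p‖)) := by
    have : z 0 ^ 2 ≤ 4 := by rw [← sq_abs]; nlinarith [abs_nonneg (z 0)]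
    calc (4 * (z 0 * (τ * p 0))) ^ 2 = τ * p 0 * (τ * (16 * z 0 ^ 2 * p 0)) := by ring
      _ ≤ τ * p 0 * (τ * (16 * 4 * ‖p‖)) := by gcongr
      _ = _ := by ring
  have t2 : |τ * p 0 * (8 * z 0 * (m1 - m))| ≤ τ * p 0 * (τ * (64 * ‖p‖ + 16 * ‖p‖ ^ 2)) := by
    rw [abs_mul, abs_of_pos (mul_pos hτ hp), abs_mul, abs_mul, abs_of_pos (by norm_num : (0:ℝ) < 8)]
    calc _ ≤ τ * p 0 * (8 * 2 * (τ * (4 * ‖p‖ + ‖p‖ ^ 2))) := by gcongr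
      _ = _ := by ring
  calc _ ≤ _ := add_le_add (h1.trans t1) t2
    _ = _ := by ring

lemma Good.asymp {k : E (n + 2) → ℝ} (hk : Good k) {p : E (n + 2)} (hp : 0 < p 0) :
    ∃ C R0 : ℝ, 0 < R0 ∧ ∀ R, R0 ≤ R →
      |hav k p R / p 0 - ∫ z : E (n + 2), k (R • z) * (R⁻¹ * (8 * z 0 * max (1 - ‖z‖ ^ 2) 0))|
        ≤ C * R⁻¹ := by
  obtain ⟨C, hC⟩ := hk.lip
  have hkc : Continuous k := hk.cd.continuous
  refine ⟨C * 2 * (128 * ‖p‖ + 16 * ‖p‖ ^ 2) * volume.real (closedBall (0 : E (n + 2)) 2),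
    1 + ‖p‖, by positivity, fun R hR => ?_⟩
  have hR1 : 1 ≤ R := le_trans (by linarith [norm_nonneg p]) hR
  have hR0 : 0 < R := by linarith
  set τ := R⁻¹ with hτd
  have hτ : 0 < τ := inv_pos.2 hR0
  have hτ1 : τ ≤ 1 := inv_le_one_of_one_le₀ hR1
  have hτp : τ * ‖p‖ ≤ 1 := by
    rw [hτd, inv_mul_le_iff₀ hR0]; linarith
  have hRτ : R * τ = 1 := mul_inv_cancel₀ hR0.ne'
  rw [hav_eq hkc p hR0, div_eq_inv_mul, ← integral_const_mul, ← integral_sub]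
  · rw [← Real.norm_eq_abs]
    have hb := norm_integral_le_of_norm_le (μ := (volume : Measure (E (n + 2))))
      (f := fun z => (p 0)⁻¹ * (k (R • z) * (rho (z - τ • p) - rho (z - sg (τ • p)))) -
        k (R • z) * (τ * (8 * z 0 * max (1 - ‖z‖ ^ 2) 0)))
      (g := (closedBall (0 : E (n + 2)) 2).indicator
        fun _ => C * 2 * (τ * (128 * ‖p‖ + 16 * ‖p‖ ^ 2))) ?_ ?_
    · refine hb.trans (le_of_eq ?_)
      rw [integral_indicator_const _ measurableSet_closedBall, smul_eq_mul]
      ring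
    · exact (integrable_indicator_iff measurableSet_closedBall).2
        (integrableOn_const (measure_closedBall_lt_top.ne))
    · refine Eventually.of_forall fun z => ?_
      have e1 : (p 0)⁻¹ * (k (R • z) * (rho (z - τ • p) - rho (z - sg (τ • p)))) -
          k (R • z) * (τ * (8 * z 0 * max (1 - ‖z‖ ^ 2) 0)) =
          k (R • z) * (p 0)⁻¹ * ((rho (z - τ • p) - rho (z - sg (τ • p))) -
            τ * p 0 * (8 * z 0 * max (1 - ‖z‖ ^ 2) 0)) := by
        field_simp
      rw [e1]
      by_cases hz : z ∈ closedBall (0 : E (n + 2)) 2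
      · rw [indicator_of_mem hz]
        rw [mem_closedBall, dist_zero_right] at hz
        have h1 := ker_diff hp hτ hτ1 hz
        have h2 : k (R • z) ≤ C * (R * 2) := by
          refine (hk.le_lin hC _).trans ?_
          gcongr
          refine max_le ?_ (by positivity)
          simp only [PiLp.smul_apply, smul_eq_mul]
          gcongr
          exact (le_abs_self _).trans ((coord_le_norm z 0).trans hz)
        rw [norm_mul, norm_mul, Real.norm_of_nonneg (hk.nonneg _),
          Real.norm_of_nonneg (inv_nonneg.2 hp.le), Real.norm_eq_abs]
        calc _ ≤ C * (R * 2) * (p 0)⁻¹ * (τ * p 0 * (τ * (128 * ‖p‖ + 16 * ‖p‖ ^ 2))) := by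
              gcongr
          _ = (R * τ) * ((p 0)⁻¹ * p 0) * (C * 2 * (τ * (128 * ‖p‖ + 16 * ‖p‖ ^ 2))) := by ring
          _ = _ := by rw [hRτ, inv_mul_cancel₀ hp.ne']; ring
      · rw [indicator_of_notMem hz]
        rw [mem_closedBall, dist_zero_right, not_le] at hz
        have hn : ‖τ • p‖ ≤ 1 := by rwa [norm_smul, Real.norm_of_nonneg hτ.le]
        rw [rho_zero, rho_zero, max_eq_right (by nlinarith)]
        · simp
        · have := norm_sub_norm_le z (sg (τ • p)); rw [norm_sg] at this; linarith
        · have := norm_sub_norm_le z (τ • p); linarith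
  · exact (hav_int hkc _ _).const_mul _
  · refine Continuous.integrable_of_hasCompactSupport (by fun_prop) ?_
    refine HasCompactSupport.intro (isCompact_closedBall 0 1) fun z hz => ?_
    simp only [mem_closedBall, dist_zero_right, not_le] at hz
    rw [max_eq_right (by nlinarith)]; simp

/-- Liouville type theorem: two disjoint nonnegative subharmonic functions of linear growth
cannot coexist in a half space. -/
lemma liouville {k₁ k₂ : E (n + 2) → ℝ} (h₁ : Good k₁) (h₂ : Good k₂)
    (hd : ∀ x, k₁ x = 0 ∨ k₂ x = 0) : (∀ x, k₁ x = 0) ∨ ∀ x, k₂ x = 0 := by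
  by_contra hcon
  push Not at hcon
  obtain ⟨A, hA, hAle, p, hp, hpA⟩ := h₁.exists_sup hcon.1
  obtain ⟨B, hB, hBle, q, hq, hqB⟩ := h₂.exists_sup hcon.2
  obtain ⟨C1, R1, hR1, hC1⟩ := h₂.asymp hp
  obtain ⟨C2, R2, hR2, hC2⟩ := h₂.asymp hq
  have hc0 := c0_pos (n := n + 2)
  have hk₁ : Continuous k₁ := h₁.cd.continuous
  have hk₂ : Continuous k₂ := h₂.cd.continuous
  have key : ∀ R, R1 + R2 ≤ R → c0 (n + 2) / 2 ≤ (C1 + C2) / B * R⁻¹ := by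
    intro R hR
    have hR0 : 0 < R := by linarith
    have a1 := hC1 R (by linarith)
    have a2 := hC2 R (by linarith)
    have b1 := h₁.hav_ge hp hR0
    have b2 := h₂.hav_ge hq hR0
    have b3 : hav (fun x => A⁻¹ * k₁ x + B⁻¹ * k₂ x) p R ≤ p 0 * c0 (n + 2) := by
      refine hav_le (by fun_prop) (fun x hx => by simp [h₁.zero x hx, h₂.zero x hx]) ?_ hp hR0
      intro x
      have hm : 0 ≤ max (x 0) 0 := le_max_right _ _
      rcases hd x with h | h
      · rw [h, mul_zero, zero_add, inv_mul_le_iff₀ hB]; exact hBle x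
      · rw [h, mul_zero, add_zero, inv_mul_le_iff₀ hA]; exact hAle x
    have b4 : hav (fun x => A⁻¹ * k₁ x + B⁻¹ * k₂ x) p R =
        A⁻¹ * hav k₁ p R + B⁻¹ * hav k₂ p R := by
      rw [hav_eq (by fun_prop) p hR0, hav_eq hk₁ p hR0, hav_eq hk₂ p hR0, ← integral_const_mul,
        ← integral_const_mul, ← integral_add ((hav_int hk₁ _ _).const_mul _)
          ((hav_int hk₂ _ _).const_mul _)]
      congr 1; ext z; ring
    rw [b4] at b3
    have d1 : 3 / 4 * c0 (n + 2) ≤ A⁻¹ * (hav k₁ p R / p 0) := by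
      rw [le_inv_mul_iff₀ hA, le_div_iff₀ hp]
      nlinarith
    have d2 : 3 / 4 * c0 (n + 2) ≤ B⁻¹ * (hav k₂ q R / q 0) := by
      rw [le_inv_mul_iff₀ hB, le_div_iff₀ hq]
      nlinarith
    have d3 : A⁻¹ * (hav k₁ p R / p 0) + B⁻¹ * (hav k₂ p R / p 0) ≤ c0 (n + 2) := by
      have : A⁻¹ * (hav k₁ p R / p 0) + B⁻¹ * (hav k₂ p R / p 0) =
        (A⁻¹ * hav k₁ p R + B⁻¹ * hav k₂ p R) / p 0 := by ring
      rw [this, div_le_iff₀ hp]; linarith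
    have d4 : hav k₂ q R / q 0 - hav k₂ p R / p 0 ≤ (C1 + C2) * R⁻¹ := by
      have := abs_le.1 a1; have := abs_le.1 a2; linarith
    have d5 : B⁻¹ * (hav k₂ q R / q 0 - hav k₂ p R / p 0) ≤ B⁻¹ * ((C1 + C2) * R⁻¹) := by
      have := inv_pos.2 hB; gcongr
    have d6 : (C1 + C2) / B * R⁻¹ = B⁻¹ * ((C1 + C2) * R⁻¹) := by ring
    rw [d6]; linarith
  have hlim : Tendsto (fun R : ℝ => (C1 + C2) / B * R⁻¹) atTop (nhds ((C1 + C2) / B * 0)) :=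
    tendsto_inv_atTop_zero.const_mul _
  rw [mul_zero] at hlim
  have := ge_of_tendsto hlim (eventually_atTop.2 ⟨R1 + R2, key⟩)
  linarith


/-- a smooth cutoff -/
def gm (s : ℝ) : ℝ := max s 0 ^ 2 / (1 + max s 0 ^ 2)

lemma gm_hasDerivAt (s : ℝ) : HasDerivAt gm (2 * max s 0 / (1 + max s 0 ^ 2) ^ 2) s := by
  have h := tp_hasDerivAt 0 s
  have hp : (1 + max s 0 ^ (0 + 2)) ≠ 0 := by positivity
  have h2 := h.div (h.const_add 1) hp
  unfold gm
  refine HasDerivAt.congr_deriv h2 ?_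
  congr 1
  push_cast
  simp only [zero_add, pow_one]
  ring

lemma gm_nonneg (s : ℝ) : 0 ≤ gm s := by unfold gm; positivity
lemma gm_le_one (s : ℝ) : gm s ≤ 1 := by
  unfold gm; rw [div_le_one (by positivity)]; linarith
lemma gm_zero {s : ℝ} (h : s ≤ 0) : gm s = 0 := by simp [gm, max_eq_right h]
lemma gm_pos {s : ℝ} (h : 0 < s) : 0 < gm s := by
  unfold gm; rw [max_eq_left h.le]; positivity

lemma gm_lip (s t : ℝ) : |gm s - gm t| ≤ |s - t| := by
  have h : LipschitzWith 1 gm := by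
    refine lipschitzWith_of_nnnorm_deriv_le (fun s => (gm_hasDerivAt s).differentiableAt) fun s => ?_
    rw [(gm_hasDerivAt s).deriv]
    rw [← NNReal.coe_le_coe, coe_nnnorm, Real.norm_eq_abs, NNReal.coe_one, abs_of_nonneg (by positivity)]
    rw [div_le_one (by positivity)]
    have : 0 ≤ max s 0 := le_max_right _ _
    nlinarith [sq_nonneg (max s 0 - 1), sq_nonneg (max s 0), sq_nonneg (max s 0 ^ 2)]
  simpa [Real.dist_eq] using h.dist_le_mul s t

lemma gm_cont : Continuous gm := continuous_iff_continuousAt.2 fun s => (gm_hasDerivAt s).continuousAt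

/-- primitive of the cutoff -/
def bt (s : ℝ) : ℝ := ∫ t in (0:ℝ)..s, gm t

lemma bt_hasDerivAt (s : ℝ) : HasDerivAt bt (gm s) s :=
  (gm_cont.integral_hasStrictDerivAt 0 s).hasDerivAt

lemma bt_zero {s : ℝ} (h : s ≤ 0) : bt s = 0 := by
  unfold bt
  rw [intervalIntegral.integral_congr (g := fun _ => 0)]
  · simp
  · intro _ ht
    rw [uIcc_of_ge h] at ht
    exact gm_zero ht.2

lemma bt_pos {s : ℝ} (h : 0 < s) : 0 < bt s :=
  intervalIntegral.intervalIntegral_pos_of_pos_on (gm_cont.intervalIntegrable _ _)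
    (fun t ht => gm_pos ht.1) h

lemma bt_nonneg (s : ℝ) : 0 ≤ bt s := by
  rcases le_or_gt s 0 with h | h
  · exact (bt_zero h).ge
  · exact (bt_pos h).le

lemma bt_comp_fderiv {v : E n → ℝ} (hc : ContDiff ℝ 1 v) (x : E n) :
    HasFDerivAt (fun x => bt (v x)) (gm (v x) • fderiv ℝ v x) x :=
  (bt_hasDerivAt (v x)).comp_hasFDerivAt x (hc.differentiable (by simp) x).hasFDerivAt

lemma good_comp {v : E (n + 2) → ℝ} {C K : ℝ≥0} (hc : ContDiff ℝ 1 v)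
    (hC : ∀ x, ‖fderiv ℝ v x‖ ≤ C) (hK : LipschitzWith K (fderiv ℝ v))
    (hl : ∀ᵐ x, 0 < v x → lap v x = 0) (hz : ∀ x : E (n + 2), x 0 ≤ 0 → v x ≤ 0) :
    Good fun x => bt (v x) := by
  have hfd : fderiv ℝ (fun x => bt (v x)) = fun x => gm (v x) • fderiv ℝ v x :=
    funext fun x => (bt_comp_fderiv hc x).fderiv
  have hvl : LipschitzWith C v :=
    lipschitzWith_of_nnnorm_fderiv_le (hc.differentiable (by simp)) hC
  refine ⟨?_, ⟨C, ?_⟩, ⟨C * C + K, ?_⟩, fun x => bt_nonneg _, fun x hx => bt_zero (hz x hx), ?_⟩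
  · rw [contDiff_one_iff_fderiv]
    refine ⟨fun x => (bt_comp_fderiv hc x).differentiableAt, ?_⟩
    rw [hfd]
    exact (gm_cont.comp hc.continuous).smul hK.continuous
  · refine lipschitzWith_of_nnnorm_fderiv_le (𝕜 := ℝ)
      (fun x => (bt_comp_fderiv hc x).differentiableAt) fun x => ?_
    rw [hfd, ← NNReal.coe_le_coe, coe_nnnorm, norm_smul, Real.norm_eq_abs, abs_of_nonneg (gm_nonneg _)]
    have := hC x
    nlinarith [gm_le_one (v x), norm_nonneg (fderiv ℝ v x)]
  · rw [hfd]
    refine LipschitzWith.of_dist_le_mul fun x y => ?_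
    rw [dist_eq_norm]
    have e : gm (v x) • fderiv ℝ v x - gm (v y) • fderiv ℝ v y
        = (gm (v x) - gm (v y)) • fderiv ℝ v x + gm (v y) • (fderiv ℝ v x - fderiv ℝ v y) := by
      rw [sub_smul, smul_sub]; abel
    rw [e]
    refine (norm_add_le _ _).trans ?_
    rw [norm_smul, norm_smul, Real.norm_eq_abs, Real.norm_eq_abs, abs_of_nonneg (gm_nonneg (v y))]
    have h1 : |gm (v x) - gm (v y)| ≤ C * dist x y :=
      (gm_lip _ _).trans (by simpa [Real.dist_eq] using hvl.dist_le_mul x y)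
    have h2 : ‖fderiv ℝ v x - fderiv ℝ v y‖ ≤ K * dist x y := by
      simpa [dist_eq_norm] using hK.dist_le_mul x y
    have h3 : |gm (v x) - gm (v y)| * ‖fderiv ℝ v x‖ ≤ (C * dist x y) * C := by
      gcongr
      exact hC x
    have h4 : gm (v y) * ‖fderiv ℝ v x - fderiv ℝ v y‖ ≤ 1 * (K * dist x y) := by
      gcongr
      exact gm_le_one _
    push_cast
    linarith
  · filter_upwards [hl, pd_diff_ae hK] with x hx hd
    have e : lap (fun x => bt (v x)) x = ∑ i, (2 * max (v x) 0 / (1 + max (v x) 0 ^ 2) ^ 2 * pd v i x ^ 2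
        + gm (v x) * fderiv ℝ (pd v i) x (EuclideanSpace.single i 1)) := by
      unfold lap
      refine Finset.sum_congr rfl fun i _ => ?_
      rw [hfd]
      have h1 : HasFDerivAt (fun y => gm (v y)) _ x :=
        (gm_hasDerivAt (v x)).comp_hasFDerivAt x (hc.differentiable (by simp) x).hasFDerivAt
      have h2 := h1.mul (hd i).hasFDerivAt
      have h3 : (fun y => (gm (v y) • fderiv ℝ v y) (EuclideanSpace.single i 1))
          = (fun y => gm (v y)) * pd v i := by ext y; simp [pd]
      rw [h3, h2.fderiv]
      simp [pd]
      ring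
    rw [e, Finset.sum_add_distrib, ← Finset.mul_sum, ← Finset.mul_sum]
    have h0 : gm (v x) * ∑ i, fderiv ℝ (pd v i) x (EuclideanSpace.single i 1) = 0 := by
      rcases le_or_gt (v x) 0 with h | h
      · rw [gm_zero h, zero_mul]
      · have := hx h
        unfold lap at this
        rw [this, mul_zero]
    rw [h0, add_zero]
    have : 0 ≤ max (v x) 0 := le_max_right _ _
    exact mul_nonneg (by positivity) (Finset.sum_nonneg fun i _ => sq_nonneg _)


lemma lap_add_mul {u v : E n → ℝ} {x : E n} (hu : Differentiable ℝ u) (hv : Differentiable ℝ v)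
    (hu2 : ∀ i, DifferentiableAt ℝ (pd u i) x) (hv2 : ∀ i, DifferentiableAt ℝ (pd v i) x) (m : ℝ) :
    lap (fun y => u y + m * v y) x = lap u x + m * lap v x := by
  unfold lap
  rw [Finset.mul_sum, ← Finset.sum_add_distrib]
  refine Finset.sum_congr rfl fun i _ => ?_
  have h : (fun y => fderiv ℝ (fun y => u y + m * v y) y (EuclideanSpace.single i 1))
      = fun y => pd u i y + m * pd v i y := by
    ext y
    have := ((hu y).hasFDerivAt.add ((hv y).hasFDerivAt.const_mul m)).fderiv
    have e : (fun y => u y + m * v y) = (u + fun y => m * v y) := rfl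
    rw [e, this]
    simp [pd]
  have h2 := (hu2 i).hasFDerivAt.add ((hv2 i).hasFDerivAt.const_mul m)
  have e : (fun y => pd u i y + m * pd v i y) = (pd u i + fun y => m * pd v i y) := rfl
  rw [h, e, h2.fderiv]
  simp

/-- the Hopf barrier -/
def hb (d : ℝ) (c x : E n) : ℝ := (1 - ‖x - c‖ ^ 2) + d * (1 - ‖x - c‖ ^ 2) ^ 2

lemma nsq_fd (c x : E n) :
    HasFDerivAt (fun x : E n => 1 - ‖x - c‖ ^ 2) (-(2 • innerSL ℝ (x - c))) x := by
  have h1 : HasFDerivAt (fun x : E n => x - c) (ContinuousLinearMap.id ℝ (E n)) x :=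
    (hasFDerivAt_id x).sub_const c
  simpa using h1.norm_sq.const_sub 1

lemma hb_fd (d : ℝ) (c x : E n) (i : Fin n) :
    pd (hb d c) i x = (1 + 2 * d * (1 - ‖x - c‖ ^ 2)) * (-2 * (x i - c i)) := by
  have h := (nsq_fd c x)
  have h2 := (h.add ((h.pow 2).const_mul d)).fderiv
  have e : hb d c = (fun x : E n => 1 - ‖x - c‖ ^ 2) +
    fun x => d * (1 - ‖x - c‖ ^ 2) ^ 2 := rfl
  unfold pd
  rw [e, h2]
  simp [EuclideanSpace.inner_single_right]
  ring

lemma hb_contDiff (d : ℝ) (c : E n) {m : WithTop ℕ∞} : ContDiff ℝ m (hb d c) := by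
  unfold hb
  have : ContDiff ℝ m (fun x : E n => ‖x - c‖ ^ 2) := (contDiff_id.sub contDiff_const).norm_sq ℝ
  fun_prop

lemma hb_lap (d : ℝ) (c x : E n) :
    lap (hb d c) x = 8 * d * ‖x - c‖ ^ 2 - 2 * n * (1 + 2 * d * (1 - ‖x - c‖ ^ 2)) := by
  have key : ∀ i, fderiv ℝ (pd (hb d c) i) x (EuclideanSpace.single i 1) =
      8 * d * (x i - c i) ^ 2 - 2 * (1 + 2 * d * (1 - ‖x - c‖ ^ 2)) := by
    intro i
    have e : pd (hb d c) i = (fun x : E n => 1 + 2 * d * (1 - ‖x - c‖ ^ 2)) * 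
      fun x => (-2 * (x i - c i)) := funext fun x => hb_fd d c x i
    have h1 := (((nsq_fd c x).const_mul (2 * d)).const_add 1)
    have h2 : HasFDerivAt (fun x : E n => x i) (EuclideanSpace.proj i : E n →L[ℝ] ℝ) x :=
      (EuclideanSpace.proj i : E n →L[ℝ] ℝ).hasFDerivAt
    have h3 := (h2.sub_const (c i)).const_mul (-2)
    rw [e, (h1.mul h3).fderiv]
    simp [EuclideanSpace.inner_single_right]
    ring
  have hs : ‖x - c‖ ^ 2 = ∑ i, (x i - c i) ^ 2 := by
    rw [EuclideanSpace.norm_sq_eq]; simp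
  have : lap (hb d c) x = ∑ i, (8 * d * (x i - c i) ^ 2 - 2 * (1 + 2 * d * (1 - ‖x - c‖ ^ 2))) :=
    Finset.sum_congr rfl fun i _ => key i
  rw [this, Finset.sum_sub_distrib, ← Finset.mul_sum, ← hs]
  simp
  ring

lemma exists_barrier (d : ℝ) (c : E n) : ∃ B : E n → ℝ, ∃ K : ℝ≥0, ContDiff ℝ 2 B ∧
    LipschitzWith K (fderiv ℝ B) ∧ ∀ x ∈ ball c 2, B =ᶠ[nhds x] hb d c := by
  let f : ContDiffBump c := ⟨2, 3, by norm_num, by norm_num⟩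
  have hB : ContDiff ℝ 2 fun x => f x * hb d c x := f.contDiff.mul (hb_contDiff d c)
  have hs : HasCompactSupport fun x => f x * hb d c x := f.hasCompactSupport.mul_right
  obtain ⟨K, hK⟩ := ContDiff.lipschitzWith_of_hasCompactSupport (𝕂 := ℝ) (n := 1) (hs.fderiv ℝ)
    (hB.fderiv_right (by norm_num)) (by simp)
  refine ⟨_, K, hB, hK, fun x hx => ?_⟩
  filter_upwards [isOpen_ball.mem_nhds hx] with y hy
  rw [f.one_of_mem_closedBall (ball_subset_closedBall hy), one_mul]

lemma neg_of_neg {u : E (n + 2) → ℝ} {K : ℝ≥0} (hc : ContDiff ℝ 1 u)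
    (hK : LipschitzWith K (fderiv ℝ u)) (hl : ∀ᵐ x, 0 ≤ lap u x)
    (hneg : ∀ x : E (n + 2), x 0 ≤ 0 → u x ≤ 0) {q : E (n + 2)} (hq : q 0 < 0) (hq2 : u q < 0) :
    ∀ x : E (n + 2), x 0 < 0 → u x < 0 := by
  have hconv : Convex ℝ {x : E (n + 2) | x 0 < 0} :=
    convex_halfSpace_lt (f := fun x : E (n + 2) => x 0) ⟨fun x y => by simp, fun c x => by simp⟩ 0
  have hH : {x : E (n + 2) | x 0 < 0} ⊆ {x | u x < 0} ∪ interior {x | u x = 0} := by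
    intro p hp
    have hp' : p 0 < 0 := hp
    rcases lt_or_ge (u p) 0 with h | h
    · exact Or.inl h
    · right
      have hb : ∀ x ∈ ball p (-p 0), x 0 ≤ 0 := by
        intro x hx
        rw [mem_ball, dist_eq_norm] at hx
        have := (le_abs_self _).trans (coord_le_norm (x - p) 0)
        simp at this
        linarith
      have hp0 : u p = 0 := le_antisymm (hneg p hp'.le) h
      have := smp hc hK p (R := -p 0) (by linarith) (hl.mono fun x hx _ => hx)
        (fun x hx => by rw [hp0]; exact hneg x (hb x hx))
      rw [mem_interior_iff_mem_nhds]
      filter_upwards [isOpen_ball.mem_nhds (mem_ball_self (x := p) (show (0:ℝ) < -p 0 by linarith))]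
        with x hx
      change u x = 0
      rw [this x hx, hp0]
  have hdis : Disjoint {x | u x < 0} (interior {x | u x = 0}) := by
    rw [Set.disjoint_left]
    intro x h1 h2
    have h3 : x ∈ {x | u x = 0} := interior_subset h2
    have h3 : u x = 0 := h3
    have h1 : u x < 0 := h1
    linarith
  exact IsPreconnected.subset_left_of_subset_union (isOpen_lt hc.continuous continuous_const)
    isOpen_interior hdis hH ⟨q, hq, hq2⟩ hconv.isPreconnected

set_option maxHeartbeats 1000000 in
lemma hopf {u : E (n + 2) → ℝ} {K : ℝ≥0} (hc : ContDiff ℝ 1 u)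
    (hK : LipschitzWith K (fderiv ℝ u)) (hl : ∀ᵐ x, 0 ≤ lap u x)
    (hneg : ∀ x : E (n + 2), x 0 ≤ 0 → u x ≤ 0) (hn : ∀ x : E (n + 2), x 0 < 0 → u x < 0)
    (h0 : u 0 = 0) (hd0 : fderiv ℝ u 0 = 0) : False := by
  obtain ⟨d, hd⟩ : ∃ d : ℝ, d = (n + 2 : ℕ) := ⟨_, rfl⟩
  have hd2 : 2 ≤ d := by rw [hd]; push_cast; linarith [Nat.cast_nonneg (α := ℝ) n]
  have hdi : 0 < 1 / (2 * d) := by positivity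
  have hdi2 : d * (1 / (2 * d)) = 1 / 2 := by field_simp
  have hdi1 : 1 / (2 * d) ≤ 1 / 4 := by rw [div_le_div_iff₀] <;> linarith
  set e0 : E (n + 2) := EuclideanSpace.single 0 1 with he0
  have hne : ‖e0‖ = 1 := norm_single_one 0
  set c : E (n + 2) := -e0 with hcdef
  have hc0 : c 0 = -1 := by simp [hcdef, he0]
  obtain ⟨B, L, hB, hL, hBe⟩ := exists_barrier d c
  have hx0 : ∀ x : E (n + 2), x 0 + 1 ≤ ‖x - c‖ := by
    intro x
    have := (le_abs_self _).trans (coord_le_norm (x - c) 0)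
    simpa [hc0] using this
  have hBeq : ∀ x : E (n + 2), ‖x - c‖ ^ 2 ≤ 1 → B x = hb d c x := fun x hx =>
    (hBe x (by rw [mem_ball, dist_eq_norm]; nlinarith [norm_nonneg (x - c)])).eq_of_nhds
  have hcn : Continuous fun x : E (n + 2) => ‖x - c‖ ^ 2 := by fun_prop
  -- lower bound on the inner sphere
  obtain ⟨m, hm, hmu⟩ : ∃ m : ℝ, 0 < m ∧ ∀ x : E (n + 2), ‖x - c‖ ^ 2 = 1 - 1 / (2 * d) → u x ≤ -m := by
    have hcl : IsClosed {x : E (n + 2) | ‖x - c‖ ^ 2 = 1 - 1 / (2 * d)} :=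
      isClosed_eq hcn continuous_const
    have hcomp : IsCompact {x : E (n + 2) | ‖x - c‖ ^ 2 = 1 - 1 / (2 * d)} := by
      refine (isCompact_closedBall c 1).of_isClosed_subset hcl fun x hx => ?_
      rw [mem_ofPred_eq] at hx
      rw [mem_closedBall, dist_eq_norm]
      nlinarith [norm_nonneg (x - c)]
    rcases Set.eq_empty_or_nonempty {x : E (n + 2) | ‖x - c‖ ^ 2 = 1 - 1 / (2 * d)} with h | h
    · refine ⟨1, one_pos, fun x hx => ?_⟩
      have : x ∈ {x : E (n + 2) | ‖x - c‖ ^ 2 = 1 - 1 / (2 * d)} := hx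
      rw [h] at this
      exact this.elim
    · obtain ⟨y, hy, hy2⟩ := hcomp.exists_isMaxOn h hc.continuous.continuousOn
      refine ⟨-u y, ?_, fun x hx => ?_⟩
      · have := hx0 y
        rw [mem_ofPred_eq] at hy
        have h3 : y 0 < 0 := by nlinarith [norm_nonneg (y - c)]
        linarith [hn y h3]
      · have := hy2 hx
        rw [mem_ofPred_eq] at this
        linarith
  set A : Set (E (n + 2)) := {x | 1 - 1 / (2 * d) ≤ ‖x - c‖ ^ 2 ∧ ‖x - c‖ ^ 2 ≤ 1} with hA
  have hAc : IsCompact A := by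
    refine (isCompact_closedBall c 1).of_isClosed_subset
      ((isClosed_le continuous_const hcn).inter (isClosed_le hcn continuous_const)) fun x hx => ?_
    rw [mem_closedBall, dist_eq_norm]
    nlinarith [norm_nonneg (x - c), hx.2]
  have hA0 : (0 : E (n + 2)) ∈ A := by
    have : ‖(0 : E (n + 2)) - c‖ = 1 := by simp [hcdef, hne]
    refine ⟨?_, ?_⟩ <;> rw [this] <;> linarith
  set w : E (n + 2) → ℝ := fun x => u x + m * B x with hw
  have hB1 : ContDiff ℝ 1 B := hB.of_le (by norm_num)
  have hwc : ContDiff ℝ 1 w := hc.add (contDiff_const.mul hB1)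
  have hwfd : fderiv ℝ w = fderiv ℝ u + m • fderiv ℝ B := by
    ext1 x
    exact ((hc.differentiable (by simp) x).hasFDerivAt.add
      ((hB1.differentiable (by simp) x).hasFDerivAt.const_mul m)).fderiv
  have hwK : LipschitzWith (K + ‖m‖₊ * L) (fderiv ℝ w) := by
    rw [hwfd]
    exact hK.add ((lipschitzWith_smul m).comp hL : LipschitzWith _ (fun x => m • fderiv ℝ B x))
  have hwl : ∀ᵐ x, x ∈ A → 0 ≤ lap w x := by
    filter_upwards [hl, pd_diff_ae hK] with x h1 h2 hx
    have hBd : ∀ i, DifferentiableAt ℝ (pd B i) x := by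
      intro i
      have h5 : ContDiff ℝ 1 (fderiv ℝ B) := hB.fderiv_right (by norm_num)
      exact (h5.clm_apply contDiff_const).differentiable (by simp) x
    rw [hw, lap_add_mul (hc.differentiable (by simp)) (hB1.differentiable (by simp)) h2 hBd,
      lap_congr (hBe x (by rw [mem_ball, dist_eq_norm]; nlinarith [norm_nonneg (x - c), hx.2])),
      hb_lap, ← hd]
    have : 0 ≤ 8 * d * ‖x - c‖ ^ 2 - 2 * d * (1 + 2 * d * (1 - ‖x - c‖ ^ 2)) := by
      have h3 := hx.1
      have h4 : d * (1 - ‖x - c‖ ^ 2) ≤ 1 / 2 := by nlinarith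
      nlinarith
    nlinarith [mul_nonneg hm.le this]
  -- maximum principle on the annulus
  have hwA : ∀ x ∈ A, w x ≤ 0 := by
    obtain ⟨z, hz, hzmax⟩ := hAc.exists_isMaxOn ⟨0, hA0⟩ hwc.continuous.continuousOn
    have hT : IsCompact (A ∩ {x | w x = w z}) :=
      hAc.inter_right (isClosed_eq hwc.continuous continuous_const)
    obtain ⟨y, hy, hymax⟩ := hT.exists_isMaxOn ⟨z, hz, rfl⟩ hcn.continuousOn
    have hwy : w y = w z := hy.2
    suffices w y ≤ 0 from fun x hx => by
      have h6 : w x ≤ w z := hzmax hx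
      linarith
    rcases eq_or_lt_of_le hy.1.2 with h | h
    · have h7 : y 0 ≤ 0 := by
        have := hx0 y
        nlinarith [norm_nonneg (y - c)]
      have : B y = 0 := by rw [hBeq y h.le]; simp [hb, h]
      simp only [hw, this]
      linarith [hneg y h7]
    rcases eq_or_lt_of_le hy.1.1 with h' | h'
    · have := hmu y h'.symm
      have h8 : B y = 1 / (2 * d) + d * (1 / (2 * d)) ^ 2 := by
        rw [hBeq y h.le]; simp only [hb, ← h']; ring
      have h9 : B y ≤ 1 := by rw [h8]; nlinarith
      simp only [hw]
      nlinarith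
    · exfalso
      have hopen : IsOpen {x : E (n + 2) | 1 - 1 / (2 * d) < ‖x - c‖ ^ 2 ∧ ‖x - c‖ ^ 2 < 1} :=
        (isOpen_lt continuous_const hcn).inter (isOpen_lt hcn continuous_const)
      obtain ⟨R, hR, hRs⟩ := Metric.isOpen_iff.1 hopen y ⟨h', h⟩
      have hRA : ball y R ⊆ A := fun x hx => ⟨(hRs hx).1.le, (hRs hx).2.le⟩
      have hsm := smp hwc hwK y hR (hwl.mono fun x hx hx2 => hx (hRA hx2))
        (fun x hx => by rw [hwy]; exact hzmax (hRA hx))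
      have hyc : ‖y - c‖ < 1 := by nlinarith [norm_nonneg (y - c)]
      have hyc0 : 0 < ‖y - c‖ := by nlinarith [norm_nonneg (y - c)]
      have hp : y + (R / 2) • (y - c) ∈ ball y R := by
        rw [mem_ball, dist_eq_norm, add_sub_cancel_left, norm_smul, Real.norm_of_nonneg (by positivity)]
        nlinarith
      have h10 := hymax (show y + (R / 2) • (y - c) ∈ A ∩ {x | w x = w z} from
        ⟨hRA hp, (hsm _ hp).trans hwy⟩)
      rw [mem_ofPred_eq] at h10
      have h11 : y + (R / 2) • (y - c) - c = (1 + R / 2) • (y - c) := by module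
      dsimp only at h10
      rw [h11, norm_smul, Real.norm_of_nonneg (by positivity)] at h10
      have : ‖y - c‖ < (1 + R / 2) * ‖y - c‖ := by nlinarith
      nlinarith
  -- conclusion at the boundary point
  have hub : ∀ s : ℝ, 0 < s → -(K * s ^ 2) ≤ u ((-s) • e0) := by
    intro s hs
    have hmem : (-s) • e0 ∈ closedBall (0 : E (n + 2)) s := by
      rw [mem_closedBall, dist_zero_right, norm_smul, hne, Real.norm_eq_abs, abs_neg, abs_of_pos hs,
        mul_one]
    have := (convex_closedBall (0 : E (n + 2)) s).norm_image_sub_le_of_norm_fderiv_le (𝕜 := ℝ) (f := u)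
      (C := K * s) (fun x _ => hc.differentiable (by simp) x) (fun x hx => by
        have := hK.dist_le_mul x 0
        rw [hd0, dist_zero_right] at this
        refine this.trans ?_
        gcongr
        exact hx) (mem_closedBall_self hs.le) hmem
    rw [h0, sub_zero, sub_zero, norm_smul, hne, norm_neg, Real.norm_of_nonneg hs.le,
      Real.norm_eq_abs] at this
    have := neg_le_of_abs_le this
    nlinarith
  have hfin : ∀ s : ℝ, 0 < s → s ≤ 1 / (2 * d) / 2 → m ≤ K * s := by
    intro s hs hs2
    have hr : ‖(-s) • e0 - c‖ = 1 - s := by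
      have : (-s) • e0 - c = (1 - s) • e0 := by rw [hcdef]; module
      rw [this, norm_smul, hne, Real.norm_of_nonneg (by linarith), mul_one]
    have hmem : (-s) • e0 ∈ A := by
      refine ⟨?_, ?_⟩ <;> rw [hr] <;> nlinarith
    have h1 := hwA _ hmem
    have h2 : s ≤ B ((-s) • e0) := by
      rw [hBeq _ hmem.2, hb, hr]
      have : 0 ≤ d * (1 - (1 - s) ^ 2) ^ 2 := by positivity
      nlinarith
    have h3 := hub s hs
    simp only [hw] at h1
    have : m * s ≤ (K * s) * s := by nlinarith
    exact le_of_mul_le_mul_right this hs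
  have hs1 : 0 < min (1 / (2 * d) / 2) (m / (2 * (K + 1))) := by positivity
  have h1 := hfin _ hs1 (min_le_left _ _)
  have h2 : K * min (1 / (2 * d) / 2) (m / (2 * (K + 1))) ≤ K * (m / (2 * (K + 1))) := by
    gcongr; exact min_le_right _ _
  have h3 : (K : ℝ) * (m / (2 * (K + 1))) < m := by
    rw [mul_div_assoc', div_lt_iff₀ (by positivity)]
    nlinarith [NNReal.coe_nonneg K, mul_nonneg hm.le (NNReal.coe_nonneg K)]
  linarith

lemma zero_half {u : E (n + 2) → ℝ} {K : ℝ≥0} (hc : ContDiff ℝ 1 u)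
    (hK : LipschitzWith K (fderiv ℝ u)) (hl : ∀ᵐ x, 0 ≤ lap u x)
    (hneg : ∀ x : E (n + 2), x 0 ≤ 0 → u x ≤ 0)
    (h0 : u 0 = 0) (hd0 : fderiv ℝ u 0 = 0) : ∀ x : E (n + 2), x 0 ≤ 0 → u x = 0 := by
  have hlt : ∀ x : E (n + 2), x 0 < 0 → u x = 0 := by
    intro q hq
    by_contra hne
    have hq2 : u q < 0 := lt_of_le_of_ne (hneg q hq.le) hne
    exact hopf hc hK hl hneg (neg_of_neg hc hK hl hneg hq hq2) h0 hd0
  intro x hx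
  have ht : Tendsto (fun s : ℝ => u (x - s • EuclideanSpace.single 0 1)) (nhdsWithin 0 (Ioi 0))
      (nhds (u (x - (0:ℝ) • EuclideanSpace.single 0 1))) := by
    refine Tendsto.mono_left (Continuous.tendsto ?_ 0) nhdsWithin_le_nhds
    have := hc.continuous
    fun_prop
  have ht2 : Tendsto (fun s : ℝ => u (x - s • EuclideanSpace.single 0 1)) (nhdsWithin 0 (Ioi 0))
      (nhds 0) := by
    refine tendsto_const_nhds.congr' ?_
    filter_upwards [self_mem_nhdsWithin] with s hs
    rw [hlt]
    simp
    linarith [mem_Ioi.1 hs]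
  have := tendsto_nhds_unique ht ht2
  simpa using this


lemma taylor {u : E n → ℝ} {K : ℝ≥0} (hc : ContDiff ℝ 1 u)
    (hK : LipschitzWith K (fderiv ℝ u)) (x h : E n) :
    |u (x + h) - u x - fderiv ℝ u x h| ≤ K * ‖h‖ ^ 2 := by
  have hmem : x + h ∈ closedBall x ‖h‖ := by simp
  have := (convex_closedBall x ‖h‖).norm_image_sub_le_of_norm_fderiv_le' (𝕜 := ℝ) (f := u)
    (φ := fderiv ℝ u x) (C := K * ‖h‖) (fun y _ => hc.differentiable (by simp) y) (fun y hy => by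
      have := hK.dist_le_mul y x
      rw [dist_eq_norm] at this
      refine this.trans ?_
      gcongr
      exact hy) (mem_closedBall_self (norm_nonneg h)) hmem
  rw [add_sub_cancel_left, Real.norm_eq_abs] at this
  linarith

lemma quot_fd {u : E n → ℝ} (hc : ContDiff ℝ 1 u) (c ε : ℝ) (h x : E n) :
    HasFDerivAt (fun x => c * (u (x + h) - u x) - ε) (c • (fderiv ℝ u (x + h) - fderiv ℝ u x)) x := by
  have h1 : HasFDerivAt (fun x => u (x + h)) (fderiv ℝ u (x + h)) x := by
    rw [hasFDerivAt_comp_add_right]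
    exact (hc.differentiable (by simp) _).hasFDerivAt
  exact ((h1.sub (hc.differentiable (by simp) x).hasFDerivAt).const_mul c).sub_const ε

lemma quot_lap {u : E n → ℝ} (hc : ContDiff ℝ 1 u) (c ε : ℝ) (h x : E n)
    (h1 : ∀ i, DifferentiableAt ℝ (pd u i) x) (h2 : ∀ i, DifferentiableAt ℝ (pd u i) (x + h)) :
    lap (fun x => c * (u (x + h) - u x) - ε) x = c * (lap u (x + h) - lap u x) := by
  unfold lap
  rw [← Finset.sum_sub_distrib, Finset.mul_sum]
  refine Finset.sum_congr rfl fun i _ => ?_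
  have e : (fun y => fderiv ℝ (fun x => c * (u (x + h) - u x) - ε) y (EuclideanSpace.single i 1))
      = fun y => c * (pd u i (y + h) - pd u i y) := by
    ext y
    rw [(quot_fd hc c ε h y).fderiv]
    simp [pd]
  have h3 : HasFDerivAt (fun x => pd u i (x + h)) (fderiv ℝ (pd u i) (x + h)) x := by
    rw [hasFDerivAt_comp_add_right]
    exact (h2 i).hasFDerivAt
  have h4 := ((h3.sub (h1 i).hasFDerivAt).const_mul c).fderiv
  rw [e]
  have e2 : (fun y => c * (pd u i (y + h) - pd u i y)) =
    fun y => c * ((fun x => pd u i (x + h)) - pd u i) y := rfl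
  rw [e2, h4]
  simp

lemma good_quot {u : E (n + 2) → ℝ} {K : ℝ≥0} (hc : ContDiff ℝ 1 u)
    (hK : LipschitzWith K (fderiv ℝ u))
    (hl : ∀ᵐ x, (∃ e : E (n + 2), e 0 = 0 ∧ fderiv ℝ u x e ≠ 0) → lap u x = 1)
    (hz : ∀ x : E (n + 2), x 0 ≤ 0 → u x = 0) (c ε : ℝ) (hε : 0 ≤ ε) (h : E (n + 2))
    (h0 : h 0 = 0) (hh : |c| * (K * ‖h‖ ^ 2) ≤ ε) :
    Good fun x => bt (c * (u (x + h) - u x) - ε) := by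
  have hfd : fderiv ℝ (fun x => c * (u (x + h) - u x) - ε) =
      fun x => c • (fderiv ℝ u (x + h) - fderiv ℝ u x) := funext fun x => (quot_fd hc c ε h x).fderiv
  have hKn : ∀ x y, ‖fderiv ℝ u x - fderiv ℝ u y‖ ≤ K * ‖x - y‖ := fun x y => by
    simpa [dist_eq_norm] using hK.dist_le_mul x y
  refine good_comp (C := ‖c‖₊ * (K * ‖h‖₊)) (K := ‖c‖₊ * (2 * K)) ?_ ?_ ?_ ?_ ?_
  · have := hc.comp (contDiff_id.add (contDiff_const (c := h)))
    exact (contDiff_const.mul (this.sub hc)).sub contDiff_const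
  · intro x
    rw [hfd, norm_smul]
    push_cast
    gcongr
    simpa using hKn (x + h) x
  · rw [hfd]
    refine LipschitzWith.of_dist_le_mul fun x y => ?_
    rw [dist_eq_norm, ← smul_sub, norm_smul]
    push_cast
    rw [mul_assoc]
    gcongr
    have e : fderiv ℝ u (x + h) - fderiv ℝ u x - (fderiv ℝ u (y + h) - fderiv ℝ u y)
      = (fderiv ℝ u (x + h) - fderiv ℝ u (y + h)) - (fderiv ℝ u x - fderiv ℝ u y) := by abel
    rw [e]
    refine (norm_sub_le _ _).trans ?_
    have h1 := hKn (x + h) (y + h)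
    have h2 := hKn x y
    rw [add_sub_add_right_eq_sub] at h1
    rw [dist_eq_norm]
    linarith
  · have hl2 := ae_scale hl h one_pos
    have hd2 := ae_scale (pd_diff_ae hK) h one_pos
    filter_upwards [hl, hl2, pd_diff_ae hK, hd2] with x a1 a2 a3 a4 hx
    rw [one_smul, add_comm h x] at a2 a4
    rw [quot_lap hc c ε h x a3 a4]
    have hb : K * ‖h‖ ^ 2 < |u (x + h) - u x| := by
      by_contra hcon
      push Not at hcon
      have h5 : |c| * |u (x + h) - u x| ≤ |c| * (K * ‖h‖ ^ 2) := by gcongr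
      have h6 := le_abs_self (c * (u (x + h) - u x))
      rw [abs_mul] at h6
      linarith
    have b1 : fderiv ℝ u x h ≠ 0 := by
      intro h7
      have := taylor hc hK x h
      rw [h7, sub_zero] at this
      linarith
    have b2 : fderiv ℝ u (x + h) h ≠ 0 := by
      intro h7
      have := taylor hc hK (x + h) (-h)
      rw [map_neg, h7, neg_zero, sub_zero, add_neg_cancel_right, norm_neg, abs_sub_comm] at this
      linarith
    rw [a1 ⟨h, h0, b1⟩, a2 ⟨h, h0, b2⟩, sub_self, mul_zero]
  · intro x hx
    rw [hz x hx, hz (x + h) (by simpa [h0] using hx)]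
    simpa using hε

lemma no_sign_change {u : E (n + 2) → ℝ} {K : ℝ≥0} (hc : ContDiff ℝ 1 u)
    (hK : LipschitzWith K (fderiv ℝ u))
    (hl : ∀ᵐ x, (∃ e : E (n + 2), e 0 = 0 ∧ fderiv ℝ u x e ≠ 0) → lap u x = 1)
    (hz : ∀ x : E (n + 2), x 0 ≤ 0 → u x = 0) (e : E (n + 2)) (h0 : e 0 = 0) (p q : E (n + 2))
    (hp : 0 < fderiv ℝ u p e) : 0 ≤ fderiv ℝ u q e := by
  by_contra hq
  push Not at hq
  obtain ⟨ε, hε, hε1, hε2⟩ : ∃ ε : ℝ, 0 < ε ∧ 2 * ε < fderiv ℝ u p e ∧ 2 * ε < -fderiv ℝ u q e := by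
    refine ⟨min (fderiv ℝ u p e) (-fderiv ℝ u q e) / 3, ?_, ?_, ?_⟩
    · have : 0 < min (fderiv ℝ u p e) (-fderiv ℝ u q e) := lt_min hp (by linarith)
      positivity
    · have := min_le_left (fderiv ℝ u p e) (-fderiv ℝ u q e); linarith
    · have := min_le_right (fderiv ℝ u p e) (-fderiv ℝ u q e); linarith
  obtain ⟨t, ht, ht2⟩ : ∃ t : ℝ, 0 < t ∧ t * (K * ‖e‖ ^ 2) ≤ ε := by
    refine ⟨ε / (K * ‖e‖ ^ 2 + 1), by positivity, ?_⟩
    rw [div_mul_eq_mul_div, div_le_iff₀ (by positivity)]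
    nlinarith [mul_nonneg (NNReal.coe_nonneg K) (sq_nonneg ‖e‖)]
  have hn : ‖t • e‖ ^ 2 = t ^ 2 * ‖e‖ ^ 2 := by rw [norm_smul, mul_pow, Real.norm_eq_abs, sq_abs]
  have hh : |t⁻¹| * (K * ‖t • e‖ ^ 2) ≤ ε := by
    rw [hn, abs_of_pos (by positivity)]
    calc t⁻¹ * (K * (t ^ 2 * ‖e‖ ^ 2)) = t * (K * ‖e‖ ^ 2) := by field_simp
      _ ≤ ε := ht2
  have g1 := good_quot hc hK hl hz t⁻¹ ε hε.le (t • e) (by simp [h0]) hh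
  have g2 := good_quot hc hK hl hz (-t⁻¹) ε hε.le (t • e) (by simp [h0]) (by rwa [abs_neg])
  have key : ∀ x, |t⁻¹ * (u (x + t • e) - u x) - fderiv ℝ u x e| ≤ ε := by
    intro x
    have h1 := taylor hc hK x (t • e)
    have h2 : t⁻¹ * (u (x + t • e) - u x) - fderiv ℝ u x e =
        t⁻¹ * (u (x + t • e) - u x - fderiv ℝ u x (t • e)) := by
      rw [map_smul, smul_eq_mul]; field_simp
    rw [h2, abs_mul]
    refine le_trans ?_ hh
    gcongr
  rcases liouville g1 g2 (fun x => by
    rcases le_or_gt (t⁻¹ * (u (x + t • e) - u x) - ε) 0 with h | h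
    · exact Or.inl (bt_zero h)
    · exact Or.inr (bt_zero (by linarith))) with h | h
  · have h1 := abs_le.1 (key p)
    have := bt_pos (show 0 < t⁻¹ * (u (p + t • e) - u p) - ε by linarith)
    have h2 := h p
    linarith
  · have h1 := abs_le.1 (key q)
    have := bt_pos (show 0 < -t⁻¹ * (u (q + t • e) - u q) - ε by linarith)
    have h2 := h q
    linarith

lemma exists_dir (D : E (n + 2) → (E (n + 2) →L[ℝ] ℝ))
    (hD : ∀ e : E (n + 2), e 0 = 0 → ∀ p q, 0 < D p e → 0 ≤ D q e) :
    ∃ e : E (n + 2), ‖e‖ = 1 ∧ e 0 = 0 ∧ (∀ x, 0 ≤ D x e) ∧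
      ∀ x f, f 0 = 0 → ⟪f, e⟫ = 0 → D x f = 0 := by
  by_cases hall : ∀ x f, f 0 = 0 → D x f = 0
  · have h0 : (EuclideanSpace.single 1 1 : E (n + 2)) 0 = 0 := by simp
    exact ⟨EuclideanSpace.single 1 1, norm_single_one 1, h0, fun x => (hall x _ h0).ge,
      fun x f hf _ => hall x f hf⟩
  · push Not at hall
    obtain ⟨p, f₀, hf₀, hpf⟩ := hall
    set G : E (n + 2) := (InnerProductSpace.toDual ℝ (E (n + 2))).symm (D p) with hG
    set g : E (n + 2) := G - (G 0) • EuclideanSpace.single 0 1 with hg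
    have hg0 : g 0 = 0 := by simp [hg]
    have hDp : ∀ f : E (n + 2), f 0 = 0 → D p f = ⟪g, f⟫ := by
      intro f hf
      rw [hg, inner_sub_left, real_inner_smul_left, EuclideanSpace.inner_single_left, hf, hG,
        InnerProductSpace.toDual_symm_apply]
      simp
    have hgne : g ≠ 0 := by
      intro h
      rw [hDp f₀ hf₀, h, inner_zero_left] at hpf
      exact hpf rfl
    have hgn : 0 < ‖g‖ := norm_pos_iff.2 hgne
    set e : E (n + 2) := ‖g‖⁻¹ • g with he
    have he0 : e 0 = 0 := by simp [he, hg0]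
    have hDe : D p e = ‖g‖ := by
      rw [hDp e he0, he, real_inner_smul_right, real_inner_self_eq_norm_sq]
      field_simp
    have hpos : ∀ f : E (n + 2), f 0 = 0 → ⟪f, e⟫ = 0 → ∀ L x, 0 ≤ D x e + L * D x f := by
      intro f hf hfe L x
      have h1 : D p f = 0 := by
        rw [hDp f hf, real_inner_comm]
        have : g = ‖g‖ • e := by rw [he, smul_inv_smul₀ hgn.ne']
        rw [this, real_inner_smul_right, hfe, mul_zero]
      have := hD (e + L • f) (by simp [he0, hf]) p x (by simp [h1, hDe, hgn])
      simpa using this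
    refine ⟨e, ?_, he0, fun x => ?_, fun x f hf hfe => ?_⟩
    · rw [he, norm_smul, norm_inv, norm_norm, inv_mul_cancel₀ hgn.ne']
    · exact hD e he0 p x (by rw [hDe]; exact hgn)
    · by_contra hne
      have h1 := hpos f hf hfe (-(D x e + 1) / D x f) x
      rw [div_mul_cancel₀ _ hne] at h1
      linarith

lemma line_deriv {u : E n → ℝ} (hc : ContDiff ℝ 1 u) (b f : E n) (t : ℝ) :
    HasDerivAt (fun t : ℝ => u (b + t • f)) (fderiv ℝ u (b + t • f) f) t := by
  have h1 : HasDerivAt (fun t : ℝ => b + t • f) f t := by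
    simpa using ((hasDerivAt_id t).smul_const f).const_add b
  exact (hc.differentiable (by simp) _).hasFDerivAt.comp_hasDerivAt t h1

lemma gradient_zero_iff {u : E n → ℝ} (x : E n) : gradient u x = 0 ↔ fderiv ℝ u x = 0 := by
  unfold gradient
  exact (InnerProductSpace.toDual ℝ (E n)).symm.map_eq_zero_iff

theorem main_aux (n : ℕ) (M a : ℝ)
    (u ψ : E (n + 2) → ℝ)
    (hpsi : ψ = fun x => a / 2 * max (x 0) 0 ^ 2)
    (hP : Pinf (n + 2) M a u ψ) :
    volume (interior (Lam univ u)) ≠ 0 ∧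
    ∃ e : E (n + 2), ‖e‖ = 1 ∧ ⟪e, (EuclideanSpace.single 0 1 : E (n + 2))⟫ = 0 ∧
      ∃ w : ℝ → ℝ → ℝ, (∀ x, u x = w (x 0) ⟪x, e⟫) ∧ ∀ s : ℝ, Monotone (w s) := by
  have hc := hP.u_c1
  have hK := hP.u_c11
  have ha := hP.ha
  have hcl : IsClosed (Lam univ u) := by
    have : Lam univ u = {x | u x = 0} ∩ {x | fderiv ℝ u x = 0} := by
      ext x; simp [Lam, gradient_zero_iff]
    rw [this]
    exact (isClosed_eq hc.continuous continuous_const).inter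
      (isClosed_eq hK.continuous continuous_const)
  have h0 : (0 : E (n + 2)) ∈ Lam univ u := hcl.frontier_subset hP.zero_mem
  have hl : ∀ᵐ x, 0 ≤ lap u x := by
    filter_upwards [hP.u_eq] with x hx
    rw [hx]
    refine add_nonneg ?_ ?_
    · exact Set.indicator_nonneg (fun _ _ => zero_le_one) _
    · exact Set.indicator_nonneg (fun _ _ => by linarith) _
  have hz := zero_half hc hK hl (fun x hx => by
    have := hP.u_le x
    rw [hpsi] at this
    simpa [max_eq_right hx] using this) h0.2.1 ((gradient_zero_iff _).1 h0.2.2)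
  refine ⟨?_, ?_⟩
  · have hop : IsOpen {x : E (n + 2) | x 0 < 0} := isOpen_lt (coord_cont 0) continuous_const
    have hsub : {x : E (n + 2) | x 0 < 0} ⊆ interior (Lam univ u) := by
      refine interior_maximal (fun x hx => ?_) hop
      have hev : u =ᶠ[nhds x] fun _ => 0 := by
        filter_upwards [hop.mem_nhds hx] with y hy
        exact hz y (le_of_lt hy)
      refine ⟨mem_univ _, hz x (le_of_lt hx), ?_⟩
      rw [gradient_zero_iff, hev.fderiv_eq]
      simp
    have hne : ({x : E (n + 2) | x 0 < 0}).Nonempty :=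
      ⟨-EuclideanSpace.single 0 1, by simp⟩
    exact (lt_of_lt_of_le (hop.measure_pos volume hne) (measure_mono hsub)).ne'
  have hl1 : ∀ᵐ x, (∃ e : E (n + 2), e 0 = 0 ∧ fderiv ℝ u x e ≠ 0) → lap u x = 1 := by
    filter_upwards [hP.u_eq] with x hx ⟨e, he, hne⟩
    have hO : x ∈ Om univ u := by
      refine ⟨mem_univ _, fun hL => hne ?_⟩
      rw [(gradient_zero_iff x).1 hL.2.2]
      simp
    have hlt : u x < ψ x := by
      refine lt_of_le_of_ne (hP.u_le x) fun heq => hne ?_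
      have hmin : IsLocalMin (fun t : ℝ => a / 2 * max (x 0) 0 ^ 2 - u (x + t • e)) 0 := by
        refine Eventually.of_forall fun t => ?_
        have h1 := hP.u_le (x + t • e)
        rw [hpsi] at h1 heq
        simp [he] at h1 heq ⊢
        linarith
      have := hmin.hasDerivAt_eq_zero ((line_deriv hc x e 0).const_sub _)
      simpa using this
    rw [hx, Set.indicator_of_mem (show x ∈ Om univ u ∩ {y | u y < ψ y} from ⟨hO, hlt⟩),
      Set.indicator_of_notMem (show x ∉ Om univ u ∩ {y | u y = ψ y} from fun h => hlt.ne h.2),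
      add_zero]
  obtain ⟨e, he1, he0, hpos, hperp⟩ := exists_dir (fderiv ℝ u)
    (fun e he p q hp => no_sign_change hc hK hl1 hz e he p q hp)
  refine ⟨e, he1, by rw [EuclideanSpace.inner_single_right, he0]; simp,
    fun s t => u (s • EuclideanSpace.single 0 1 + t • e), fun x => ?_, fun s => ?_⟩
  · set b : E (n + 2) := x 0 • EuclideanSpace.single 0 1 + ⟪x, e⟫ • e with hb
    have hf0 : (x - b) 0 = 0 := by simp [hb, he0]
    have hfe : ⟪x - b, e⟫ = 0 := by
      rw [hb, inner_sub_left, inner_add_left, real_inner_smul_left, real_inner_smul_left,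
        EuclideanSpace.inner_single_left, he0, real_inner_self_eq_norm_sq, he1]
      simp
    have hd : ∀ t, HasDerivAt (fun t : ℝ => u (b + t • (x - b))) 0 t := fun t => by
      have := line_deriv hc b (x - b) t
      rwa [hperp _ _ hf0 hfe] at this
    have := is_const_of_deriv_eq_zero (fun t => (hd t).differentiableAt) (fun t => (hd t).deriv) 1 0
    simpa using this
  · refine monotone_of_deriv_nonneg (fun t => (line_deriv hc _ e t).differentiableAt) fun t => ?_
    rw [(line_deriv hc _ e t).deriv]
    exact hpos _

/-- **Two-dimensionality of global solutions.** If `u ∈ P_∞(M)` with upper obstacle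
`ψ(x) = (a/2)(x₁⁺)²` and `δ_r(u) ≥ ε₀ > 0` for all `r > 0`, then `Int Λ(u)` has nonzero
measure and `u` is two-dimensional: in appropriate orthonormal coordinates keeping `e₁`,
`u(x) = w(x₁, x·e)` with `w` nondecreasing in its second variable. -/
theorem global_two_dimensional (n : ℕ) (M a ε₀ : ℝ) (hε : 0 < ε₀)
    (u ψ : E (n + 2) → ℝ)
    (hpsi : ψ = fun x => a / 2 * max (x 0) 0 ^ 2)
    (hP : Pinf (n + 2) M a u ψ)
    (hthick : ∀ r : ℝ, 0 < r → ε₀ ≤ thick univ u r) :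
    volume (interior (Lam univ u)) ≠ 0 ∧
    ∃ e : E (n + 2), ‖e‖ = 1 ∧ ⟪e, (EuclideanSpace.single 0 1 : E (n + 2))⟫ = 0 ∧
      ∃ w : ℝ → ℝ → ℝ, (∀ x, u x = w (x 0) ⟪x, e⟫) ∧ ∀ s : ℝ, Monotone (w s) := by
  exact main_aux n M a u ψ hpsi hP
end
end

section
/- (Positivity of global solutions.) Let u ∈ P_∞(M) with upper obstacle ψ(x) = (a/2)(x₁⁺)² in ℝⁿ, and assume there exists ε₀ > 0 such that δ_r(u) ≥ ε₀ for all r > 0. Then u ≥ 0 everywhere, and u satisfies Δu = χ_{{0<u<ψ}} + a·χ_{{0<u=ψ}} with 0 ≤ u ≤ ψ almost everywhere. -/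
/- Setting: the double obstacle problem
   Δu = f·χ_{Ω(u)∩{u<ψ}} + Δψ·χ_{Ω(u)∩{u=ψ}},  u ≤ ψ,
   following "Regularity of the free boundary for the double obstacle problem". -/

open Set Metric MeasureTheory Filter
open scoped RealInnerProductSpace NNReal

noncomputable section

variable {n : ℕ}

/-- Lipschitz images of null sets are null. -/
lemma lip_null {m : ℕ} {G : E m → E m} {N : Set (E m)} {K : ℝ≥0}
    (hG : LipschitzOnWith K G N) (hN : volume N = 0) : volume (G '' N) = 0 := by
  have hfin : Module.finrank ℝ (E m) = m := by simp
  have h1 : (Measure.hausdorffMeasure (Module.finrank ℝ (E m) : ℝ) : Measure (E m)) N = 0 :=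
    Measure.absolutelyContinuous_isAddHaarMeasure _ volume hN
  have h2 : (Measure.hausdorffMeasure (Module.finrank ℝ (E m) : ℝ) : Measure (E m)) (G '' N) = 0 := by
    have := hG.hausdorffMeasure_image_le (d := (Module.finrank ℝ (E m) : ℝ)) (Nat.cast_nonneg _)
    rw [h1, mul_zero] at this
    exact le_antisymm this (zero_le)
  exact Measure.absolutelyContinuous_isAddHaarMeasure volume
    (Measure.hausdorffMeasure (Module.finrank ℝ (E m) : ℝ)) h2

/-- One dimensional second order necessary condition. -/
lemma second_test {φ φ' : ℝ → ℝ} {A : ℝ} (hm : IsLocalMin φ 0)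
    (h1 : ∀ t, HasDerivAt φ (φ' t) t) (h2 : HasDerivAt φ' A 0) : 0 ≤ A := by
  by_contra hA
  push Not at hA
  have hd : deriv φ = φ' := funext fun t => (h1 t).deriv
  have h0 : φ' 0 = 0 := hm.hasDerivAt_eq_zero (h1 0)
  have hM : IsLocalMax φ 0 :=
    isLocalMax_of_deriv_deriv_neg (by rw [hd, h2.deriv]; exact hA) (by rw [hd, h0])
      (h1 0).continuousAt
  have hc : φ =ᶠ[nhds 0] fun _ => φ 0 := by
    filter_upwards [hm, hM] with t a b using le_antisymm b a
  have hc2 : deriv φ =ᶠ[nhds 0] deriv (fun _ : ℝ => φ 0) := hc.deriv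
  have := hc2.deriv_eq
  rw [hd, h2.deriv] at this
  simp at this
  linarith

lemma line_deriv_s9 {m : ℕ} {f : E m → ℝ} (x e : E m) (t : ℝ) (hf : Differentiable ℝ f) :
    HasDerivAt (fun t : ℝ => f (x + t • e)) (fderiv ℝ f (x + t • e) e) t := by
  have h1 : HasDerivAt (fun t : ℝ => x + t • e) e t := by
    simpa using ((hasDerivAt_id t).smul_const e).const_add x
  exact (hf (x + t • e)).hasFDerivAt.comp_hasDerivAt t h1

lemma line_deriv0 {m : ℕ} {f : E m → ℝ} (x e : E m) (hf : DifferentiableAt ℝ f x) :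
    HasDerivAt (fun t : ℝ => f (x + t • e)) (fderiv ℝ f x e) 0 := by
  have h1 : HasDerivAt (fun t : ℝ => x + t • e) e 0 := by
    simpa using ((hasDerivAt_id (0:ℝ)).smul_const e).const_add x
  have h2 : HasFDerivAt f (fderiv ℝ f x) (x + (0:ℝ) • e) := by simpa using hf.hasFDerivAt
  exact h2.comp_hasDerivAt 0 h1

/-- `C^{1,1}` functions: differentiable with globally Lipschitz derivative. -/
def C11 {m : ℕ} (w : E m → ℝ) : Prop :=
  Differentiable ℝ w ∧ ∃ K : ℝ≥0, LipschitzWith K (fderiv ℝ w)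

lemma C11.ae_diff {m : ℕ} {w : E m → ℝ} (hw : C11 w) :
    ∀ᵐ x : E m, ∀ e : E m, DifferentiableAt ℝ (fun y => fderiv ℝ w y e) x := by
  obtain ⟨hd, K, hK⟩ := hw
  filter_upwards [hK.ae_differentiableAt (μ := volume)] with x hx e
  exact hx.clm_apply (differentiableAt_const e)

/-- Weak minimum principle for `C^{1,1}` functions (ABP argument). -/
lemma core {m : ℕ} {K U : Set (E m)} (hK : IsCompact K) (hU : IsOpen U) (hUK : U ⊆ K)
    {w β : E m → ℝ} {l : ℝ} (hw : C11 w) (hβ : ContDiff ℝ 2 β)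
    (hlw : ∀ᵐ x : E m, x ∈ U → lap w x ≤ l) (hlβ : ∀ x ∈ U, l < lap β x)
    (hb : ∀ x ∈ K, x ∉ U → β x ≤ w x) : ∀ x ∈ K, β x ≤ w x := by
  by_contra hcon
  push Not at hcon
  obtain ⟨z, hzK, hz⟩ := hcon
  have hβ1 : ContDiff ℝ 1 (fderiv ℝ β) := hβ.fderiv_right (by norm_num)
  have hβd : Differentiable ℝ β := hβ.differentiable (by norm_num)
  have hwd : Differentiable ℝ w := hw.1
  obtain ⟨K1, hK1⟩ := hw.2
  obtain ⟨K2, hK2⟩ := LocallyLipschitzOn.exists_lipschitzOnWith_of_compact hK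
    (hβ1.locallyLipschitz.locallyLipschitzOn (s := K))
  obtain ⟨R, hR0, hR⟩ : ∃ R : ℝ, 0 < R ∧ ∀ x ∈ K, ‖x - z‖ ≤ R := by
    obtain ⟨R, hR⟩ := hK.isBounded.subset_closedBall z
    refine ⟨max R 1, by positivity, fun x hx => ?_⟩
    have := hR hx
    rw [mem_closedBall, dist_eq_norm] at this
    exact this.trans (le_max_left _ _)
  set G : E m → E m := fun x => (InnerProductSpace.toDual ℝ (E m)).symm (fderiv ℝ w x - fderiv ℝ β x)
    with hG
  have hGl : LipschitzOnWith (K1 + K2) G K := by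
    have h3 : LipschitzOnWith (K1 + K2) (fun x => fderiv ℝ w x - fderiv ℝ β x) K :=
      (hK1.lipschitzOnWith (s := K)).sub hK2
    have h4 := ((InnerProductSpace.toDual ℝ (E m)).symm.lipschitz).comp_lipschitzOnWith h3
    simpa [hG, Function.comp_def] using h4
  set N : Set (E m) := {x | x ∈ U ∧ ¬ (lap w x ≤ l ∧
    ∀ e : E m, DifferentiableAt ℝ (fun y => fderiv ℝ w y e) x)} with hN
  have hN0 : volume N = 0 := by
    have h5 : ∀ᵐ x : E m, x ∉ N := by
      filter_upwards [hlw, hw.ae_diff] with x h1 h2 h3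
      exact h3.2 ⟨h1 h3.1, h2⟩
    simpa [ae_iff] using h5
  have hGN := lip_null (hGl.mono (fun x hx => hUK hx.1 : N ⊆ K)) hN0
  set η := β z - w z with hη
  have hη0 : 0 < η := by simp [hη, hz]
  have hball : ∃ p ∈ ball (0 : E m) (η / R), p ∉ G '' N := by
    by_contra hc
    push Not at hc
    have h6 : volume (ball (0 : E m) (η / R)) ≤ volume (G '' N) := measure_mono hc
    rw [hGN] at h6
    exact absurd (measure_ball_pos volume (0 : E m) (div_pos hη0 hR0)) (by simpa using h6)
  obtain ⟨p, hp, hpN⟩ := hball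
  set f : E m → ℝ := fun x => w x - β x - ⟪p, x - z⟫ with hf
  have hfd : Differentiable ℝ f := by
    intro x
    exact ((hwd x).sub (hβd x)).sub ((differentiableAt_const p).inner ℝ
      (differentiableAt_id.sub (differentiableAt_const z)))
  obtain ⟨y, hyK, hy⟩ := hK.exists_isMinOn ⟨z, hzK⟩ hfd.continuous.continuousOn
  have hfz : f z = -η := by simp [hf, hη]
  have hyU : y ∈ U := by
    by_contra hyU
    have h7 := hb y hyK hyU
    have h8 : f y ≤ f z := hy hzK
    have h9 : ⟪p, y - z⟫ ≤ ‖p‖ * ‖y - z‖ := real_inner_le_norm _ _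
    have h10 : ‖p‖ < η / R := by simpa using hp
    have h11 : ‖p‖ * ‖y - z‖ ≤ ‖p‖ * R := by gcongr; exact hR y hyK
    have h12 : ‖p‖ * R < η := by rwa [lt_div_iff₀ hR0] at h10
    have : f y = w y - β y - ⟪p, y - z⟫ := rfl
    linarith
  have hloc : IsLocalMin f y := by
    filter_upwards [hU.mem_nhds hyU] with x hx using hy (hUK hx)
  have hfder : ∀ x e, fderiv ℝ f x e = fderiv ℝ w x e - fderiv ℝ β x e - ⟪p, e⟫ := by
    intro x e
    have h1 : HasFDerivAt (fun x : E m => ⟪p, x - z⟫) (innerSL ℝ p) x := by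
      have := (innerSL ℝ p).hasFDerivAt (x := x - z)
      have h2 := this.comp x ((hasFDerivAt_id x).sub_const z)
      simpa [Function.comp_def] using h2
    have h2 : HasFDerivAt f _ x := ((hwd x).hasFDerivAt.sub (hβd x).hasFDerivAt).sub h1
    rw [h2.fderiv]
    simp
  have hgrad : G y = p := by
    rw [hG]
    simp only
    rw [LinearIsometryEquiv.symm_apply_eq]
    ext e
    have h3 : fderiv ℝ f y e = 0 := by rw [hloc.fderiv_eq_zero]; simp
    rw [hfder] at h3
    simp
    linarith
  have hgood : lap w y ≤ l ∧ ∀ e : E m, DifferentiableAt ℝ (fun y => fderiv ℝ w y e) y := by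
    by_contra hc
    exact hpN ⟨y, ⟨hyU, hc⟩, hgrad⟩
  have hle : lap β y ≤ lap w y := by
    unfold lap
    refine Finset.sum_le_sum fun i _ => ?_
    set e : E m := EuclideanSpace.single i 1
    have hdβ : DifferentiableAt ℝ (fun x => fderiv ℝ β x e) y :=
      ((hβ1.differentiable one_ne_zero) y).clm_apply (differentiableAt_const e)
    have h1 : ∀ t : ℝ, HasDerivAt (fun t : ℝ => f (y + t • e)) (fderiv ℝ f (y + t • e) e) t :=
      fun t => line_deriv_s9 y e t hfd
    have h2 : HasDerivAt (fun t : ℝ => fderiv ℝ f (y + t • e) e)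
        (fderiv ℝ (fun x => fderiv ℝ w x e) y e - fderiv ℝ (fun x => fderiv ℝ β x e) y e) 0 := by
      simp only [hfder]
      exact ((line_deriv0 y e (hgood.2 e)).sub (line_deriv0 y e hdβ)).sub_const _
    have h3 : IsLocalMin (fun t : ℝ => f (y + t • e)) 0 := by
      have hc : Tendsto (fun t : ℝ => y + t • e) (nhds 0) (nhds y) := by
        have : Continuous (fun t : ℝ => y + t • e) := by fun_prop
        simpa using this.tendsto 0
      have := hc.eventually hloc
      filter_upwards [this] with t ht
      simpa using ht
    have := second_test h3 h1 h2
    linarith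
  linarith [hlβ y hyU, hgood.1]
/-- The family of explicit barriers. -/
def bar {m : ℕ} (A C0 c d e0 : ℝ) (p : ℕ) (y : E (m + 2)) (x : E (m + 2)) : ℝ :=
  A * (C0 - ‖x - y‖ ^ 2) ^ p + c * x 0 ^ 2 + d * x 0 + e0

lemma bar_contDiff {m : ℕ} (A C0 c d e0 : ℝ) (p : ℕ) (y : E (m + 2)) :
    ContDiff ℝ 2 (bar A C0 c d e0 p y) := by
  have h1 : ContDiff ℝ 2 (fun x : E (m + 2) => ‖x - y‖ ^ 2) :=
    (contDiff_id.sub contDiff_const).norm_sq ℝ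
  have h2 : ContDiff ℝ 2 (fun x : E (m + 2) => x 0) := by fun_prop
  unfold bar
  exact (((contDiff_const.mul ((contDiff_const.sub h1).pow p)).add
    (contDiff_const.mul (h2.pow 2))).add (contDiff_const.mul h2)).add contDiff_const

lemma line_norm {m : ℕ} (y x : E (m + 2)) (i : Fin (m + 2)) :
    HasDerivAt (fun t : ℝ => ‖x + t • (EuclideanSpace.single i 1 : E (m + 2)) - y‖ ^ 2)
      (2 * (x i - y i)) 0 := by
  have h1 : HasDerivAt (fun t : ℝ => x + t • (EuclideanSpace.single i 1 : E (m + 2)) - y)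
      (EuclideanSpace.single i 1 : E (m + 2)) 0 := by
    simpa using (((hasDerivAt_id (0:ℝ)).smul_const
      (EuclideanSpace.single i 1 : E (m + 2))).const_add x).sub_const y
  have := h1.norm_sq
  simpa [EuclideanSpace.inner_single_right] using this

lemma line_coord {m : ℕ} (x e : E (m + 2)) (j : Fin (m + 2)) :
    HasDerivAt (fun t : ℝ => (x + t • e) j) (e j) 0 := by
  simpa using ((hasDerivAt_id (0:ℝ)).mul_const (e j)).const_add (x j)

lemma bar_fderiv {m : ℕ} (A C0 c d e0 : ℝ) (p : ℕ) (y x : E (m + 2)) (i : Fin (m + 2)) :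
    fderiv ℝ (bar A C0 c d e0 p y) x (EuclideanSpace.single i 1) =
      A * (p * (C0 - ‖x - y‖ ^ 2) ^ (p - 1) * (-(2 * (x i - y i))))
        + (2 * c * x 0 + d) * (EuclideanSpace.single i 1 : E (m + 2)) 0 := by
  set e : E (m + 2) := EuclideanSpace.single i 1 with he
  have h1 := line_deriv0 x e ((bar_contDiff A C0 c d e0 p y).differentiable (by norm_num) x)
  have h2 := (((((((line_norm y x i).const_sub C0).pow p).const_mul A).add
    (((line_coord x e 0).pow 2).const_mul c)).add ((line_coord x e 0).const_mul d)).add_const e0)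
  have := h1.unique h2
  rw [this]
  simp [← he]
  ring

lemma bar_lap {m : ℕ} (A C0 c d e0 : ℝ) (p : ℕ) (y x : E (m + 2)) :
    lap (bar A C0 c d e0 p y) x =
      A * p * (4 * ((p - 1 : ℕ) : ℝ) * (C0 - ‖x - y‖ ^ 2) ^ (p - 1 - 1) * ‖x - y‖ ^ 2
        - 2 * ((m : ℝ) + 2) * (C0 - ‖x - y‖ ^ 2) ^ (p - 1)) + 2 * c := by
  have hC := bar_contDiff A C0 c d e0 p y
  have hC1 : ContDiff ℝ 1 (fderiv ℝ (bar A C0 c d e0 p y)) := hC.fderiv_right (by norm_num)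
  have key : ∀ i : Fin (m + 2),
      fderiv ℝ (fun z => fderiv ℝ (bar A C0 c d e0 p y) z (EuclideanSpace.single i 1)) x
        (EuclideanSpace.single i 1) =
      A * p * (4 * ((p - 1 : ℕ) : ℝ) * (C0 - ‖x - y‖ ^ 2) ^ (p - 1 - 1) * (x i - y i) ^ 2
        - 2 * (C0 - ‖x - y‖ ^ 2) ^ (p - 1)) + (if i = 0 then 2 * c else 0) := by
    intro i
    set e : E (m + 2) := EuclideanSpace.single i 1 with he
    have hd : DifferentiableAt ℝ (fun z => fderiv ℝ (bar A C0 c d e0 p y) z e) x :=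
      ((hC1.differentiable one_ne_zero) x).clm_apply (differentiableAt_const e)
    have h1 := line_deriv0 x e hd
    have hfun : (fun t : ℝ => fderiv ℝ (bar A C0 c d e0 p y) (x + t • e) e) = fun t : ℝ =>
        A * (p * (C0 - ‖x + t • e - y‖ ^ 2) ^ (p - 1) * (-(2 * ((x + t • e) i - y i))))
        + (2 * c * (x + t • e) 0 + d) * e 0 := by
      funext t
      exact bar_fderiv A C0 c d e0 p y (x + t • e) i
    have h2 := ((((((line_norm y x i).const_sub C0).pow (p - 1)).const_mul (p : ℝ)).mul
        ((((line_coord x e i).sub_const (y i)).const_mul 2).neg)).const_mul A).add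
        ((((line_coord x e 0).const_mul (2 * c)).add_const d).mul_const (e 0))
    rw [hfun] at h1
    rw [h1.unique h2]
    have hei : e i = 1 := by simp [he]
    have he0 : e 0 = if i = 0 then 1 else 0 := by
      simp [he, eq_comm]
    rw [hei, he0]
    split_ifs <;> simp [← he] <;> ring
  unfold lap
  simp only [key]
  rw [Finset.sum_add_distrib, ← Finset.mul_sum, Finset.sum_sub_distrib, ← Finset.mul_sum]
  have hs : ∑ i, (x i - y i) ^ 2 = ‖x - y‖ ^ 2 := by
    rw [EuclideanSpace.norm_sq_eq]
    simp
  rw [hs]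
  simp
  left
  ring

lemma coord_lip {m : ℕ} (x y : E (m + 2)) : |x 0 - y 0| ≤ ‖x - y‖ := by
  have := PiLp.norm_apply_le (x - y) 0
  simpa using this
lemma lap_neg {m : ℕ} (u : E m → ℝ) (x : E m) : lap (fun y => - u y) x = - lap u x := by
  unfold lap
  rw [← Finset.sum_neg_distrib]
  refine Finset.sum_congr rfl fun i _ => ?_
  have : (fun y => fderiv ℝ (fun y => - u y) y (EuclideanSpace.single i (1:ℝ)))
      = fun y => - (fderiv ℝ u y (EuclideanSpace.single i (1:ℝ))) := by
    funext y
    have : fderiv ℝ (fun y => - u y) y = - fderiv ℝ u y := fderiv_neg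
    rw [this]; rfl
  rw [this]
  have h2 := fderiv_neg (𝕜 := ℝ) (f := fun y => fderiv ℝ u y (EuclideanSpace.single i (1:ℝ))) (x := x)
  have h3 : (fun y => - (fderiv ℝ u y (EuclideanSpace.single i (1:ℝ))))
     = - (fun y => fderiv ℝ u y (EuclideanSpace.single i (1:ℝ))) := rfl
  rw [h3, h2]; rfl

lemma C11.neg {m : ℕ} {u : E m → ℝ} (hu : C11 u) : C11 (fun x => - u x) := by
  obtain ⟨h1, K, hK⟩ := hu
  refine ⟨h1.neg, K, ?_⟩
  have : fderiv ℝ (fun x => - u x) = fun x => - fderiv ℝ u x := by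
    funext x; exact fderiv_neg
  rw [this]
  exact hK.neg

lemma ball_cmp {m : ℕ} {u : E (m + 2) → ℝ} (hu : C11 u) {x₀ : E (m + 2)} {ρ c e0 : ℝ}
    (hc : 0 ≤ c)
    (hlap : ∀ᵐ x : E (m + 2), x ∈ ball x₀ ρ → lap u x = 1)
    (hs : ∀ x ∈ sphere x₀ ρ, c * x 0 ^ 2 + e0 ≤ - u x) :
    ∀ x ∈ closedBall x₀ ρ,
      (1 + 2 * c) / (4 * (m + 2)) * (ρ ^ 2 - ‖x - x₀‖ ^ 2) + c * x 0 ^ 2 + e0 ≤ - u x := by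
  have key := core (isCompact_closedBall x₀ ρ) isOpen_ball ball_subset_closedBall
    (w := fun x => - u x) (β := bar ((1 + 2 * c) / (4 * (m + 2))) (ρ ^ 2) c 0 e0 1 x₀) (l := -1)
    hu.neg (bar_contDiff _ _ _ _ _ _ _)
    (by filter_upwards [hlap] with x hx hxb; rw [lap_neg, hx hxb])
    (by
      intro x _
      rw [bar_lap]
      have : (0:ℝ) < (m : ℝ) + 2 := by positivity
      have h2 : (1 + 2 * c) / (4 * ((m:ℝ) + 2)) * (2 * (m + 2)) = (1 + 2 * c) / 2 := by
        field_simp; ring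
      simp
      nlinarith)
    (by
      intro x hx hxn
      have hxs : x ∈ sphere x₀ ρ := by
        rw [mem_closedBall] at hx
        rw [mem_ball, not_lt] at hxn
        exact le_antisymm hx hxn
      have h1 := hs x hxs
      rw [mem_sphere, dist_eq_norm] at hxs
      simp [bar, hxs]
      linarith)
  intro x hx
  have := key x hx
  simpa [bar] using this

lemma step1_ball {m : ℕ} {u : E (m + 2) → ℝ} (hu : C11 u)
    (hle : ∀ x : E (m + 2), x 0 ≤ 0 → u x ≤ 0)
    (hlap : ∀ᵐ x : E (m + 2), u x < 0 → lap u x = 1)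
    {x₀ : E (m + 2)} (h0 : x₀ 0 < 0) (hx₀ : u x₀ < 0) :
    ∀ x ∈ ball x₀ (- x₀ 0), u x < 0 := by
  by_contra hcon
  push Not at hcon
  obtain ⟨y, hyb, hy⟩ := hcon
  set Z : Set (E (m + 2)) := {x | 0 ≤ u x} with hZ
  have hcont : Continuous u := hu.1.continuous
  have hZc : IsClosed Z := isClosed_le continuous_const hcont
  obtain ⟨z, hzZ, hz⟩ := hZc.exists_infDist_eq_dist ⟨y, hy⟩ x₀
  set ρ := infDist x₀ Z with hρ
  have hρy : ρ < - x₀ 0 := (infDist_le_dist_of_mem (x := x₀) (s := Z) hy).trans_lt (by rw [dist_comm]; exact hyb)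
  have hz0 : z 0 < 0 := by
    have h1 := coord_lip z x₀
    rw [← dist_eq_norm, dist_comm, ← hz] at h1
    have := (abs_le.mp h1).2
    linarith
  have huz : u z = 0 := le_antisymm (hle z hz0.le) hzZ
  have hρ0 : 0 < ρ := by
    rw [hz]
    refine dist_pos.mpr ?_
    rintro rfl
    linarith
  have hneg : ∀ x ∈ ball x₀ ρ, u x < 0 := by
    intro x hx
    by_contra hc
    push Not at hc
    have := infDist_le_dist_of_mem (x := x₀) (s := Z) hc
    rw [mem_ball, dist_comm] at hx
    linarith
  have hcmp := ball_cmp hu (x₀ := x₀) (ρ := ρ) (c := 0) (e0 := 0) le_rfl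
    (by filter_upwards [hlap] with x hx hxb using hx (hneg x hxb))
    (by
      intro x hx
      have h1 := coord_lip x x₀
      rw [mem_sphere, dist_eq_norm] at hx
      rw [hx] at h1
      have h2 := hle x (by linarith [(abs_le.mp h1).2])
      simp; exact h2)
  set A : ℝ := (1 + 2 * 0) / (4 * ((m:ℝ) + 2)) with hA
  have hA0 : 0 < A := by rw [hA]; positivity
  have hloc : IsLocalMax u z := by
    have : ∀ᶠ x : E (m + 2) in nhds z, x 0 < 0 := by
      have hc : Continuous (fun x : E (m + 2) => x 0) := by fun_prop
      exact (isOpen_lt hc continuous_const).mem_nhds hz0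
    filter_upwards [this] with x hx
    rw [huz]; exact hle x hx.le
  have hd := line_deriv0 z (x₀ - z) (hu.1 z)
  rw [hloc.fderiv_eq_zero] at hd
  have ht := hd.tendsto_slope_zero_right
  have hbound : ∀ᶠ t : ℝ in nhdsWithin 0 (Ioi 0),
      t⁻¹ • (u (z + (0 + t) • (x₀ - z)) - u (z + (0:ℝ) • (x₀ - z))) ≤ - (A * ρ ^ 2) := by
    filter_upwards [Ioo_mem_nhdsGT (zero_lt_one (α := ℝ))] with t ht
    have hn : ‖z + t • (x₀ - z) - x₀‖ = (1 - t) * ρ := by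
      have : z + t • (x₀ - z) - x₀ = (1 - t) • (z - x₀) := by module
      rw [this, norm_smul, ← dist_eq_norm z x₀, dist_comm z x₀, ← hz, Real.norm_eq_abs,
        abs_of_pos (by linarith [ht.2])]
    have h1 := hcmp (z + t • (x₀ - z)) (by
      rw [mem_closedBall, dist_eq_norm, hn]
      nlinarith [ht.1])
    rw [hn] at h1
    simp only [zero_add, zero_smul, add_zero, huz, sub_zero, smul_eq_mul]
    rw [inv_mul_le_iff₀ ht.1]
    have h2 : A * (ρ ^ 2 - ((1 - t) * ρ) ^ 2) = A * ρ ^ 2 * t * (2 - t) := by ring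
    rw [h2] at h1
    have h3 : 0 ≤ A * ρ ^ 2 * t * (1 - t) := by
      have := ht.1; have := ht.2
      have : 0 ≤ 1 - t := by linarith
      positivity
    nlinarith
  have := le_of_tendsto ht hbound
  simp at this
  have : 0 < A * ρ ^ 2 := by positivity
  linarith

lemma step1 {m : ℕ} {u : E (m + 2) → ℝ} (hu : C11 u)
    (hle : ∀ x : E (m + 2), x 0 ≤ 0 → u x ≤ 0)
    (hlap : ∀ᵐ x : E (m + 2), u x < 0 → lap u x = 1) :
    ∀ x : E (m + 2), x 0 < 0 → u x = 0 := by
  by_contra hcon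
  push Not at hcon
  obtain ⟨x₁, hx₁, hux₁⟩ := hcon
  have hux₁' : u x₁ < 0 := lt_of_le_of_ne (hle x₁ hx₁.le) hux₁
  set S : Set ℝ := {r | ∃ x : E (m + 2), x 0 < 0 ∧ u x < 0 ∧ r = - u x / x 0 ^ 2} with hS
  have hSne : S.Nonempty := ⟨_, x₁, hx₁, hux₁', rfl⟩
  have hSb : ∀ r ∈ S, 0 ≤ r := by
    rintro r ⟨x, hx, hux, rfl⟩
    have : 0 < - u x := by linarith
    positivity
  set c := sInf S with hc
  have hc0 : 0 ≤ c := le_csInf hSne hSb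
  have hcle : ∀ x : E (m + 2), x 0 < 0 → u x < 0 → c * x 0 ^ 2 ≤ - u x := by
    intro x hx hux
    have h1 : c ≤ - u x / x 0 ^ 2 := csInf_le ⟨0, hSb⟩ ⟨x, hx, hux, rfl⟩
    have h2 : 0 < x 0 ^ 2 := by nlinarith
    rwa [le_div_iff₀ h2] at h1
  have himp : ∀ r ∈ S, c + (1 + 2 * c) / (4 * ((m:ℝ) + 2)) / 4 ≤ r := by
    rintro r ⟨x, hx, hux, rfl⟩
    have hb := step1_ball hu hle hlap hx hux
    have hmem : ∀ y : E (m + 2), dist y x ≤ - x 0 / 2 → y ∈ ball x (- x 0) := by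
      intro y hy; rw [mem_ball]; linarith
    have h3 := ball_cmp hu (x₀ := x) (ρ := - x 0 / 2) (c := c) (e0 := 0) hc0
      (by
        filter_upwards [hlap] with y hy hyb
        rw [mem_ball] at hyb
        exact hy (hb y (hmem y hyb.le)))
      (by
        intro y hy
        rw [mem_sphere] at hy
        have h4 := hb y (hmem y hy.le)
        have h5 := coord_lip y x
        rw [← dist_eq_norm, hy] at h5
        rw [add_zero]
        exact hcle y (by linarith [(abs_le.mp h5).2]) h4)
      x (by rw [mem_closedBall, dist_self]; linarith)
    have h2 : 0 < x 0 ^ 2 := by nlinarith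
    rw [le_div_iff₀ h2]
    simp only [sub_self, norm_zero] at h3
    nlinarith
  have := le_csInf hSne himp
  have hpos : 0 < (1 + 2 * c) / (4 * ((m:ℝ) + 2)) / 4 := by positivity
  linarith
/-- First coordinate direction. -/
def e1 (m : ℕ) : E (m + 2) := EuclideanSpace.single 0 1

/-- The derivative in the first coordinate direction. -/
def D1 {m : ℕ} (u : E (m + 2) → ℝ) (x : E (m + 2)) : ℝ := fderiv ℝ u x (e1 m)

lemma e1_zero (m : ℕ) : (e1 m) 0 = 1 := by simp [e1]

lemma norm_e1 (m : ℕ) : ‖e1 m‖ = 1 := by simp [e1]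

lemma D1_lip {m : ℕ} {u : E (m + 2) → ℝ} {K : ℝ≥0} (hK : LipschitzWith K (fderiv ℝ u))
    (x y : E (m + 2)) : |D1 u x - D1 u y| ≤ K * ‖x - y‖ := by
  have h1 : D1 u x - D1 u y = (fderiv ℝ u x - fderiv ℝ u y) (e1 m) := rfl
  rw [h1, ← Real.norm_eq_abs]
  refine (ContinuousLinearMap.le_opNorm _ _).trans ?_
  rw [norm_e1, mul_one]
  simpa [dist_eq_norm] using hK.dist_le_mul x y

/-- Difference quotient in the first direction. -/
def dq {m : ℕ} (u : E (m + 2) → ℝ) (t : ℝ) (x : E (m + 2)) : ℝ :=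
  t⁻¹ * (u (x + t • e1 m) - u x)

lemma dq_near {m : ℕ} {u : E (m + 2) → ℝ} (hu : Differentiable ℝ u) {K : ℝ≥0}
    (hK : LipschitzWith K (fderiv ℝ u)) {t : ℝ} (ht : 0 < t) (x : E (m + 2)) :
    |dq u t x - D1 u x| ≤ K * t := by
  have hd : ∀ s, HasDerivAt (fun s : ℝ => u (x + s • e1 m)) (D1 u (x + s • e1 m)) s :=
    fun s => line_deriv_s9 x (e1 m) s hu
  obtain ⟨s, hs, hs2⟩ := exists_hasDerivAt_eq_slope (fun s : ℝ => u (x + s • e1 m))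
    (fun s => D1 u (x + s • e1 m)) ht
    (fun s _ => (hd s).continuousAt.continuousWithinAt) (fun s _ => hd s)
  have h1 : dq u t x = D1 u (x + s • e1 m) := by
    rw [hs2]; simp [dq]; field_simp
  rw [h1]
  refine (D1_lip hK _ _).trans ?_
  have : ‖x + s • e1 m - x‖ = s := by
    rw [add_sub_cancel_left, norm_smul, norm_e1, mul_one, Real.norm_eq_abs, abs_of_pos hs.1]
  rw [this]
  gcongr
  exact hs.2.le

lemma dq_fderiv {m : ℕ} {u : E (m + 2) → ℝ} (hu : Differentiable ℝ u) (t : ℝ) (x : E (m + 2)) :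
    fderiv ℝ (dq u t) x = t⁻¹ • (fderiv ℝ u (x + t • e1 m) - fderiv ℝ u x) := by
  have h1 : HasFDerivAt (fun x => u (x + t • e1 m)) (fderiv ℝ u (x + t • e1 m)) x := by
    have := (hu (x + t • e1 m)).hasFDerivAt.comp x ((hasFDerivAt_id x).add_const (t • e1 m))
    simpa [Function.comp_def] using this
  exact ((h1.sub (hu x).hasFDerivAt).const_mul t⁻¹).fderiv

lemma dq_C11 {m : ℕ} {u : E (m + 2) → ℝ} (hu : C11 u) (t : ℝ) : C11 (dq u t) := by
  obtain ⟨hd, K, hK⟩ := hu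
  refine ⟨?_, ‖t⁻¹‖₊ * (K + K), ?_⟩
  · unfold dq
    exact ((hd.comp (differentiable_id.add_const _)).sub hd).const_mul _
  · have h0 : fderiv ℝ (dq u t) = fun x => t⁻¹ • (fderiv ℝ u (x + t • e1 m) - fderiv ℝ u x) :=
      funext (dq_fderiv hd t)
    rw [h0]
    have h1 : LipschitzWith K (fun x => fderiv ℝ u (x + t • e1 m)) := by
      refine LipschitzWith.of_dist_le_mul fun x y => ?_
      have := hK.dist_le_mul (x + t • e1 m) (y + t • e1 m)
      simpa using this
    exact (lipschitzWith_smul t⁻¹).comp (h1.sub hK)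

lemma dq_lap {m : ℕ} {u : E (m + 2) → ℝ} (hu : C11 u) (t : ℝ) :
    ∀ᵐ x : E (m + 2), lap (dq u t) x = t⁻¹ * (lap u (x + t • e1 m) - lap u x) := by
  have hsh : ∀ᵐ x : E (m + 2), ∀ e, DifferentiableAt ℝ (fun y => fderiv ℝ u y e) (x + t • e1 m) :=
    (measurePreserving_add_right volume (t • e1 m)).quasiMeasurePreserving.ae hu.ae_diff
  filter_upwards [hu.ae_diff, hsh] with x h1 h2
  unfold lap
  rw [← Finset.sum_sub_distrib, Finset.mul_sum]
  refine Finset.sum_congr rfl fun i _ => ?_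
  set e : E (m + 2) := EuclideanSpace.single i 1
  have hf : (fun y => fderiv ℝ (dq u t) y e) =
      fun y => t⁻¹ * (fderiv ℝ u (y + t • e1 m) e - fderiv ℝ u y e) := by
    funext y
    rw [dq_fderiv hu.1]; simp
  rw [hf]
  have h3 : HasFDerivAt (fun y => fderiv ℝ u (y + t • e1 m) e)
      (fderiv ℝ (fun y => fderiv ℝ u y e) (x + t • e1 m)) x := by
    have := (h2 e).hasFDerivAt.comp x ((hasFDerivAt_id x).add_const (t • e1 m))
    simpa [Function.comp_def] using this
  have h4 : HasFDerivAt (fun y => t⁻¹ * (fderiv ℝ u (y + t • e1 m) e - fderiv ℝ u y e)) _ x :=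
    (h3.sub (h1 e).hasFDerivAt).const_mul t⁻¹
  rw [h4.fderiv]
  simp

lemma barrier {m : ℕ} {u : E (m + 2) → ℝ} (hu : C11 u) {K : ℝ≥0}
    (hK : LipschitzWith K (fderiv ℝ u))
    (hlap : ∀ᵐ x : E (m + 2), 0 < x 0 → D1 u x < 0 → lap u x = 1)
    {κ : ℝ} (hκ0 : 0 < κ) (hκ : ∀ x : E (m + 2), 0 < x 0 → 0 ≤ D1 u x + κ * x 0)
    {y : E (m + 2)} {ε R b0 σ : ℝ} {k : ℕ} (hε : 0 < ε) (hεR : ε < R) (hRy : R < y 0)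
    (hb0 : 0 < b0) (hσ : 0 < σ)
    (hin : ∀ x ∈ sphere y ε, b0 ≤ D1 u x + κ * x 0)
    (hk : ((m : ℝ) + 2) * R ^ 2 < 2 * (k + 1) * ε ^ 2)
    (hlow : b0 + σ ≤ κ * (y 0 - R)) :
    ∀ x, ε ≤ ‖x - y‖ → ‖x - y‖ ≤ R →
      b0 / (R ^ 2) ^ (k + 2) * (R ^ 2 - ‖x - y‖ ^ 2) ^ (k + 2) ≤ D1 u x + κ * x 0 := by
  have hR : 0 < R := hε.trans hεR
  set A := b0 / (R ^ 2) ^ (k + 2) with hA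
  have hA0 : 0 < A := by positivity
  have hDc : Continuous (D1 u) := by
    unfold D1
    exact hK.continuous.clm_apply continuous_const
  have hAle : ∀ x : E (m + 2), ‖x - y‖ ≤ R → A * (R ^ 2 - ‖x - y‖ ^ 2) ^ (k + 2) ≤ b0 := by
    intro x hx
    have h1 : (R ^ 2 - ‖x - y‖ ^ 2) ^ (k + 2) ≤ (R ^ 2) ^ (k + 2) := by
      have : 0 ≤ R ^ 2 - ‖x - y‖ ^ 2 := by nlinarith [norm_nonneg (x - y)]
      gcongr
      nlinarith [norm_nonneg (x - y)]
    calc A * (R ^ 2 - ‖x - y‖ ^ 2) ^ (k + 2) ≤ A * (R ^ 2) ^ (k + 2) := by gcongr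
      _ = b0 := by rw [hA]; field_simp
  have hpos : ∀ x : E (m + 2), ‖x - y‖ ≤ R → y 0 - R ≤ x 0 := by
    intro x hx
    have := (abs_le.mp (coord_lip x y)).1
    linarith
  intro x hx1 hx2
  by_cases hxD : - σ < D1 u x
  · have h1 := hAle x hx2
    have h2 := hpos x hx2
    nlinarith
  push Not at hxD
  set KK : Set (E (m + 2)) := {x | ε ≤ ‖x - y‖ ∧ ‖x - y‖ ≤ R ∧ D1 u x ≤ - σ} with hKK
  set U : Set (E (m + 2)) := {x | ε < ‖x - y‖ ∧ ‖x - y‖ < R ∧ D1 u x < - σ} with hU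
  have hnc : Continuous (fun x : E (m + 2) => ‖x - y‖) := by fun_prop
  have hKKc : IsCompact KK := by
    refine (isCompact_closedBall y R).of_isClosed_subset ?_ ?_
    · exact (isClosed_le continuous_const hnc).inter
        ((isClosed_le hnc continuous_const).inter (isClosed_le hDc continuous_const))
    · intro z hz
      rw [mem_closedBall, dist_eq_norm]; exact hz.2.1
  have hUo : IsOpen U := (isOpen_lt continuous_const hnc).inter
        ((isOpen_lt hnc continuous_const).inter (isOpen_lt hDc continuous_const))
  have hmain : ∀ t : ℝ, 0 < t → K * t < σ →
      A * (R ^ 2 - ‖x - y‖ ^ 2) ^ (k + 2) - κ * x 0 - K * t ≤ dq u t x := by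
    intro t ht htσ
    have hshift : ∀ᵐ x : E (m + 2), 0 < (x + t • e1 m) 0 → D1 u (x + t • e1 m) < 0 →
        lap u (x + t • e1 m) = 1 :=
      (measurePreserving_add_right volume (t • e1 m)).quasiMeasurePreserving.ae hlap
    have key := core hKKc hUo (fun z hz => ⟨hz.1.le, hz.2.1.le, hz.2.2.le⟩)
      (w := dq u t) (β := bar A (R ^ 2) 0 (- κ) (- (K * t)) (k + 2) y) (l := 0)
      (dq_C11 hu t) (bar_contDiff _ _ _ _ _ _ _)
      (by
        filter_upwards [dq_lap hu t, hlap, hshift] with z h1 h2 h3 hz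
        have hz0 : 0 < z 0 := by linarith [hpos z hz.2.1.le]
        have hzt : (z + t • e1 m) 0 = z 0 + t := by simp [e1_zero]
        have hD : D1 u (z + t • e1 m) < 0 := by
          have h4 := (abs_le.mp (D1_lip hK (z + t • e1 m) z)).2
          rw [add_sub_cancel_left, norm_smul, norm_e1, mul_one, Real.norm_eq_abs,
            abs_of_pos ht] at h4
          have := hz.2.2
          linarith
        rw [h1, h2 hz0 (by linarith [hz.2.2]), h3 (by rw [hzt]; linarith) hD]
        simp)
      (by
        intro z hz
        rw [bar_lap]
        have hz1 := hz.1
        have hz2 := hz.2.1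
        have hq : 0 < R ^ 2 - ‖z - y‖ ^ 2 := by nlinarith [norm_nonneg (z - y)]
        have hq2 : ε ^ 2 ≤ ‖z - y‖ ^ 2 := by gcongr
        have e1' : (k + 2 - 1 : ℕ) = k + 1 := rfl
        have e2' : (k + 2 - 1 - 1 : ℕ) = k := rfl
        rw [e2', e1']
        have h5 : A * ((k + 2 : ℕ) : ℝ) * (4 * ((k + 1 : ℕ) : ℝ) * (R ^ 2 - ‖z - y‖ ^ 2) ^ k
            * ‖z - y‖ ^ 2 - 2 * ((m : ℝ) + 2) * (R ^ 2 - ‖z - y‖ ^ 2) ^ (k + 1)) + 2 * 0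
            = A * ((k + 2 : ℕ) : ℝ) * (R ^ 2 - ‖z - y‖ ^ 2) ^ k *
              (2 * (2 * ((k + 1 : ℕ) : ℝ) * ‖z - y‖ ^ 2
                - ((m : ℝ) + 2) * (R ^ 2 - ‖z - y‖ ^ 2))) := by
          ring
        have h6 : 0 < 2 * ((k + 1 : ℕ) : ℝ) * ‖z - y‖ ^ 2
                - ((m : ℝ) + 2) * (R ^ 2 - ‖z - y‖ ^ 2) := by
          push_cast
          have h7 : 2 * ((k:ℝ) + 1) * ε ^ 2 ≤ 2 * ((k:ℝ) + 1) * ‖z - y‖ ^ 2 := by gcongr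
          have h8 : 0 ≤ ((m : ℝ) + 2) * ‖z - y‖ ^ 2 := by positivity
          nlinarith
        refine lt_of_lt_of_eq ?_ h5.symm
        positivity)
      (by
        intro z hz hzU
        have h9 := (abs_le.mp (dq_near hu.1 hK ht z)).1
        suffices h10 : A * (R ^ 2 - ‖z - y‖ ^ 2) ^ (k + 2) ≤ D1 u z + κ * z 0 by
          simp only [bar]
          linarith
        by_cases c1 : ‖z - y‖ = ε
        · exact (hAle z hz.2.1).trans (hin z (by rw [mem_sphere, dist_eq_norm]; exact c1))
        by_cases c2 : ‖z - y‖ = R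
        · rw [c2]
          simp only [sub_self]
          rw [zero_pow (by omega), mul_zero]
          exact hκ z (by linarith [hpos z hz.2.1])
        have c3 : D1 u z = - σ := by
          by_contra c3
          exact hzU ⟨lt_of_le_of_ne hz.1 (Ne.symm c1), lt_of_le_of_ne hz.2.1 c2,
            lt_of_le_of_ne hz.2.2 c3⟩
        have h1 := hAle z hz.2.1
        have h2 := hpos z hz.2.1
        nlinarith)
      x ⟨hx1, hx2, hxD⟩
    simp only [bar] at key
    linarith
  by_contra hcon
  push Not at hcon
  set g := A * (R ^ 2 - ‖x - y‖ ^ 2) ^ (k + 2) - (D1 u x + κ * x 0) with hg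
  have hg0 : 0 < g := by rw [hg]; linarith
  have hK0 : (0:ℝ) ≤ K := K.2
  set t := min σ (g / 2) / (2 * (K + 1)) with ht
  have ht0 : 0 < t := by positivity
  have hKt : K * t ≤ min σ (g / 2) / 2 := by
    rw [ht, mul_div_assoc', div_le_div_iff₀ (by positivity) (by positivity)]
    have : 0 < min σ (g / 2) := by positivity
    nlinarith
  have hm1 := min_le_left σ (g / 2)
  have hm2 := min_le_right σ (g / 2)
  have h11 := hmain t ht0 (by linarith)
  have h12 := (abs_le.mp (dq_near hu.1 hK ht0 x)).2
  linarith
lemma harnack {m : ℕ} {u : E (m + 2) → ℝ} (hu : C11 u) {K : ℝ≥0}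
    (hK : LipschitzWith K (fderiv ℝ u))
    (hlap : ∀ᵐ x : E (m + 2), 0 < x 0 → D1 u x < 0 → lap u x = 1)
    {κ : ℝ} (hκ0 : 0 < κ) (hκ : ∀ x : E (m + 2), 0 < x 0 → 0 ≤ D1 u x + κ * x 0)
    (θ : ℝ) (hθ : 0 < θ) : ∃ η > 0, ∀ x₀ y : E (m + 2), 0 < y 0 → ‖x₀ - y‖ ≤ 3 / 4 * y 0 →
      D1 u x₀ + κ * x₀ 0 ≤ η * x₀ 0 → D1 u y + κ * y 0 ≤ θ * y 0 := by
  have hK0 : (0:ℝ) ≤ K := K.2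
  set L : ℝ := K + κ + 1 with hL
  have hL0 : 0 < L := by positivity
  have hlip : ∀ x y : E (m + 2), D1 u x + κ * x 0 ≤ D1 u y + κ * y 0 + L * ‖x - y‖ := by
    intro x y
    have h1 := (abs_le.mp (D1_lip hK x y)).2
    have h2 := (abs_le.mp (coord_lip x y)).2
    have h3 := norm_nonneg (x - y)
    rw [hL]
    nlinarith
  set θ' := min θ (κ / 16) with hθ'
  have hθ'0 : 0 < θ' := by positivity
  have hθ1 : θ' ≤ θ := min_le_left _ _
  have hθ2 : θ' ≤ κ / 16 := min_le_right _ _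
  set e : ℝ := min (θ' / (2 * L)) (1 / 2) with he
  have he0 : 0 < e := by positivity
  have he1 : e ≤ 1 / 2 := min_le_right _ _
  have he2 : L * e ≤ θ' / 2 := by
    have : e ≤ θ' / (2 * L) := min_le_left _ _
    calc L * e ≤ L * (θ' / (2 * L)) := by gcongr
      _ = θ' / 2 := by field_simp
  obtain ⟨k, hk⟩ := exists_nat_gt (((m : ℝ) + 2) / (2 * e ^ 2))
  rw [div_lt_iff₀ (by positivity)] at hk
  set η := θ' / 2 * (13 / 49 : ℝ) ^ (k + 2) / 2 with hη
  have hη0 : 0 < η := by positivity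
  refine ⟨η, hη0, fun x₀ y hy hxy hx₀ => ?_⟩
  by_contra hcon
  push Not at hcon
  have hcon' : θ' * y 0 < D1 u y + κ * y 0 := by nlinarith
  have hlow : ∀ x : E (m + 2), ‖x - y‖ ≤ e * y 0 → θ' / 2 * y 0 ≤ D1 u x + κ * x 0 := by
    intro x hx
    have h1 := hlip y x
    rw [norm_sub_rev] at h1
    have h2 : L * ‖x - y‖ ≤ L * (e * y 0) := by gcongr
    have h3 : L * e * y 0 ≤ θ' / 2 * y 0 := by gcongr
    nlinarith
  have hx0y : x₀ 0 ≤ 7 / 4 * y 0 := by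
    have := (abs_le.mp (coord_lip x₀ y)).2
    linarith
  have hp : (0:ℝ) < (13 / 49 : ℝ) ^ (k + 2) := by positivity
  have hfin : θ' / 2 * y 0 * (13 / 49 : ℝ) ^ (k + 2) ≤ D1 u x₀ + κ * x₀ 0 := by
    by_cases hc : ‖x₀ - y‖ ≤ e * y 0
    · refine le_trans ?_ (hlow x₀ hc)
      have h1 : (13 / 49 : ℝ) ^ (k + 2) ≤ 1 := pow_le_one₀ (by norm_num) (by norm_num)
      have h2 : 0 < θ' / 2 * y 0 := by positivity
      nlinarith
    · push Not at hc
      have hb := barrier hu hK hlap hκ0 hκ (y := y) (ε := e * y 0) (R := 7 / 8 * y 0)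
        (b0 := θ' / 2 * y 0) (σ := κ * y 0 / 16) (k := k) (by positivity) (by nlinarith)
        (by linarith) (by positivity) (by positivity)
        (fun x hx => hlow x (by rw [mem_sphere, dist_eq_norm] at hx; exact hx.le))
        (by
          have h1 : 0 < y 0 ^ 2 := by positivity
          have h2 : ((m:ℝ) + 2) * y 0 ^ 2 < k * (2 * e ^ 2) * y 0 ^ 2 := by gcongr
          have h3 : 0 < ((m:ℝ) + 2) * y 0 ^ 2 := by positivity
          have h4 : 0 < e ^ 2 * y 0 ^ 2 := by positivity
          nlinarith)
        (by nlinarith)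
        x₀ hc.le (by linarith)
      refine le_trans ?_ hb
      have h0 : θ' / 2 * y 0 / ((7 / 8 * y 0) ^ 2) ^ (k + 2)
            * ((7 / 8 * y 0) ^ 2 - ‖x₀ - y‖ ^ 2) ^ (k + 2)
          = θ' / 2 * y 0 * (((7 / 8 * y 0) ^ 2 - ‖x₀ - y‖ ^ 2) / (7 / 8 * y 0) ^ 2) ^ (k + 2) := by
        rw [div_pow]; ring
      rw [h0]
      have h1 : (13 / 49 : ℝ) ≤ ((7 / 8 * y 0) ^ 2 - ‖x₀ - y‖ ^ 2) / (7 / 8 * y 0) ^ 2 := by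
        rw [le_div_iff₀ (by positivity)]
        have : ‖x₀ - y‖ ^ 2 ≤ (3 / 4 * y 0) ^ 2 := by gcongr
        nlinarith
      gcongr
  have h1 : η * x₀ 0 ≤ η * (7 / 4 * y 0) := by gcongr
  have h2 : 0 < θ' / 2 * y 0 * (13 / 49 : ℝ) ^ (k + 2) := by positivity
  have h3 : η * (7 / 4 * y 0) = 7 / 8 * (θ' / 2 * y 0 * (13 / 49 : ℝ) ^ (k + 2)) := by
    rw [hη]; ring
  linarith

lemma shift_coord {m : ℕ} (y : E (m + 2)) (r : ℝ) : (y + r • e1 m) 0 = y 0 + r := by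
  simp [e1_zero]

lemma chain {m : ℕ} {u : E (m + 2) → ℝ} (hu : C11 u) {K : ℝ≥0}
    (hK : LipschitzWith K (fderiv ℝ u))
    (hlap : ∀ᵐ x : E (m + 2), 0 < x 0 → D1 u x < 0 → lap u x = 1)
    {κ : ℝ} (hκ0 : 0 < κ) (hκ : ∀ x : E (m + 2), 0 < x 0 → 0 ≤ D1 u x + κ * x 0) (k : ℕ) :
    ∀ θ : ℝ, 0 < θ → ∃ η > 0, ∀ y : E (m + 2), 0 < y 0 → D1 u y + κ * y 0 ≤ η * y 0 →
      ∀ r : ℝ, (4 / 7) ^ k * y 0 ≤ r → r ≤ y 0 →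
        D1 u (y + (r - y 0) • e1 m) + κ * r ≤ θ * r := by
  induction k with
  | zero =>
    intro θ hθ
    refine ⟨θ, hθ, fun y hy h r hr1 hr2 => ?_⟩
    have : r = y 0 := le_antisymm hr2 (by simpa using hr1)
    subst this
    simpa using h
  | succ k ih =>
    intro θ hθ
    obtain ⟨η1, hη1, H1⟩ := harnack hu hK hlap hκ0 hκ θ hθ
    obtain ⟨η, hη, H⟩ := ih η1 hη1
    refine ⟨η, hη, fun y hy h r hr1 hr2 => ?_⟩
    have hr0 : 0 < r := lt_of_lt_of_le (by positivity) hr1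
    set r' := min (y 0) (7 / 4 * r) with hr'
    have h1 : (4 / 7 : ℝ) ^ k * y 0 ≤ r' := by
      refine le_min ?_ ?_
      · have : (4 / 7 : ℝ) ^ k ≤ 1 := pow_le_one₀ (by norm_num) (by norm_num)
        nlinarith
      · rw [pow_succ] at hr1
        nlinarith
    have h2 : r' ≤ y 0 := min_le_left _ _
    have h3 : r' ≤ 7 / 4 * r := min_le_right _ _
    have h4 : r ≤ r' := le_min hr2 (by linarith)
    have h5 := H y hy h r' h1 h2
    have h6 := H1 (y + (r' - y 0) • e1 m) (y + (r - y 0) • e1 m)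
      (by rw [shift_coord]; linarith)
      (by
        have : y + (r' - y 0) • e1 m - (y + (r - y 0) • e1 m) = (r' - r) • e1 m := by module
        rw [this, norm_smul, norm_e1, mul_one, Real.norm_eq_abs, abs_of_nonneg (by linarith),
          shift_coord]
        linarith)
      (by
        rw [shift_coord]
        have : y 0 + (r' - y 0) = r' := by ring
        rw [this]; exact h5)
    rw [shift_coord] at h6
    have : y 0 + (r - y 0) = r := by ring
    rwa [this] at h6

lemma mvt_le {φ φ' : ℝ → ℝ} {a b C : ℝ} (hab : a ≤ b) (h : ∀ t, HasDerivAt φ (φ' t) t)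
    (hC : ∀ t ∈ Ioo a b, φ' t ≤ C) : φ b ≤ φ a + C * (b - a) := by
  rcases hab.eq_or_lt with rfl | hab
  · simp
  obtain ⟨c, hc, hc2⟩ := exists_hasDerivAt_eq_slope φ φ' hab
    (fun s _ => (h s).continuousAt.continuousWithinAt) (fun s _ => h s)
  have h1 := hC c hc
  rw [hc2, div_le_iff₀ (by linarith)] at h1
  linarith

lemma mvt_ge {φ φ' : ℝ → ℝ} {a b : ℝ} (hab : a ≤ b) (h : ∀ t, HasDerivAt φ (φ' t) t)
    (hC : ∀ t ∈ Ioo a b, 0 ≤ φ' t) : φ a ≤ φ b := by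
  have := mvt_le (φ := fun t => - φ t) (φ' := fun t => - φ' t) (C := 0) hab (fun t => (h t).neg)
    (fun t ht => by simpa using hC t ht)
  simp at this
  exact this

lemma line_hasDeriv {m : ℕ} {u : E (m + 2) → ℝ} (hu : Differentiable ℝ u) (y : E (m + 2)) (κ r : ℝ) :
    HasDerivAt (fun r : ℝ => u (y + (r - y 0) • e1 m) + κ / 2 * r ^ 2)
      (D1 u (y + (r - y 0) • e1 m) + κ * r) r := by
  have h1 := (line_deriv_s9 y (e1 m) (r - y 0) hu)
  have h2 : HasDerivAt (fun r : ℝ => r - y 0) 1 r := (hasDerivAt_id r).sub_const _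
  have h3 := h1.comp r h2
  have h4 := ((hasDerivAt_pow 2 r).const_mul (κ / 2))
  have h5 := h3.add h4
  refine h5.congr_deriv ?_
  unfold D1
  norm_num
  ring

set_option maxHeartbeats 1600000 in
lemma improve {m : ℕ} {u : E (m + 2) → ℝ} (hu : C11 u) {K : ℝ≥0}
    (hK : LipschitzWith K (fderiv ℝ u))
    (hz : ∀ x : E (m + 2), x 0 ≤ 0 → u x = 0 ∧ D1 u x = 0)
    (hlap : ∀ᵐ x : E (m + 2), 0 < x 0 → D1 u x < 0 → lap u x = 1)
    {κ : ℝ} (hκ0 : 0 < κ) (hκ : ∀ x : E (m + 2), 0 < x 0 → 0 ≤ D1 u x + κ * x 0) :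
    ∃ η > 0, ∀ x : E (m + 2), 0 < x 0 → η * x 0 < D1 u x + κ * x 0 := by
  have hK0 : (0:ℝ) ≤ K := K.2
  set L : ℝ := K + κ with hL
  have hL0 : 0 < L := by positivity
  set A : ℝ := (1 + 2 * (κ / 2)) / (4 * ((m:ℝ) + 2)) with hA
  have hA0 : 0 < A := by positivity
  obtain ⟨k, hk⟩ := exists_pow_lt_of_lt_one (show 0 < A / 200 / L by positivity)
    (show (4 / 7 : ℝ) < 1 by norm_num)
  set s : ℝ := (4 / 7 : ℝ) ^ k with hs
  have hs0 : 0 < s := by positivity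
  have hs1 : s ≤ 1 := pow_le_one₀ (by norm_num) (by norm_num)
  have hLs : L * s ≤ A / 200 := by
    rw [lt_div_iff₀ hL0] at hk
    linarith
  set θ : ℝ := min (A / 200) (κ / 2) with hθ
  have hθ0 : 0 < θ := by positivity
  have hθ1 : θ ≤ A / 200 := min_le_left _ _
  have hθ2 : θ ≤ κ / 2 := min_le_right _ _
  obtain ⟨η1, hη1, H1⟩ := chain hu hK hlap hκ0 hκ k θ hθ0
  obtain ⟨η, hη, H⟩ := harnack hu hK hlap hκ0 hκ η1 hη1
  refine ⟨η, hη, ?_⟩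
  by_contra hcon
  push Not at hcon
  obtain ⟨x₀, hT, hx₀⟩ := hcon
  set T := x₀ 0 with hTdef
  have hcoord : ∀ y ∈ closedBall x₀ (T / 4), 3 / 4 * T ≤ y 0 ∧ y 0 ≤ 5 / 4 * T := by
    intro y hy
    rw [mem_closedBall, dist_eq_norm] at hy
    have := abs_le.mp ((coord_lip y x₀).trans hy)
    constructor <;> linarith [this.1, this.2]
  have hseg : ∀ y ∈ closedBall x₀ (T / 4), ∀ r : ℝ, s * y 0 ≤ r → r ≤ y 0 →
        D1 u (y + (r - y 0) • e1 m) + κ * r ≤ θ * r := by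
    intro y hy
    obtain ⟨h1, h2⟩ := hcoord y hy
    refine H1 y (by linarith) (H x₀ y (by linarith) ?_ hx₀)
    rw [mem_closedBall, dist_eq_norm, norm_sub_rev] at hy
    linarith
  have hcross : ∀ y : E (m + 2), u (y + (0 - y 0) • e1 m) = 0 ∧ D1 u (y + (0 - y 0) • e1 m) = 0 := by
    intro y
    exact hz _ (by rw [shift_coord]; linarith)
  have hvle : ∀ y ∈ closedBall x₀ (T / 4), u y + κ / 2 * y 0 ^ 2 ≤ A / 50 * T ^ 2 := by
    intro y hy
    obtain ⟨h1, h2⟩ := hcoord y hy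
    have hy0 : 0 < y 0 := by linarith
    have hd := line_hasDeriv hu.1 y κ
    have m1 := mvt_le (a := 0) (b := s * y 0) (C := L * s * y 0) (by positivity) hd (by
      intro r hr
      have h3 := (abs_le.mp (D1_lip hK (y + (r - y 0) • e1 m) (y + (0 - y 0) • e1 m))).2
      have h4 : y + (r - y 0) • e1 m - (y + (0 - y 0) • e1 m) = r • e1 m := by module
      rw [h4, (hcross y).2, norm_smul, norm_e1, mul_one, Real.norm_eq_abs, abs_of_pos hr.1] at h3
      have h5 : L * r ≤ L * (s * y 0) := by gcongr; exact hr.2.le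
      rw [hL] at h5 ⊢
      linarith)
    have m2 := mvt_le (a := s * y 0) (b := y 0) (C := θ * y 0) (by nlinarith) hd (by
      intro r hr
      have h3 := hseg y hy r hr.1.le hr.2.le
      have h4 : θ * r ≤ θ * y 0 := by gcongr; exact hr.2.le
      linarith)
    rw [(hcross y).1] at m1
    simp only [sub_self, zero_smul, add_zero] at m2
    have m3 : u y + κ / 2 * y 0 ^ 2 ≤ (L * s * s + θ * (1 - s)) * y 0 ^ 2 := by nlinarith
    have m4 : L * s * s + θ * (1 - s) ≤ A / 100 := by nlinarith [mul_pos hL0 hs0]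
    have m5 : y 0 ^ 2 ≤ 2 * T ^ 2 := by nlinarith
    have m6 : 0 < y 0 ^ 2 := by positivity
    nlinarith
  have hcmp := ball_cmp hu (x₀ := x₀) (ρ := T / 4) (c := κ / 2) (e0 := - (A / 50 * T ^ 2))
    (by positivity)
    (by
      filter_upwards [hlap] with y hy hyb
      have hyc := ball_subset_closedBall hyb
      obtain ⟨h1, h2⟩ := hcoord y hyc
      have hy0 : 0 < y 0 := by linarith
      have h3 := hseg y hyc (y 0) (by nlinarith) le_rfl
      simp only [sub_self, zero_smul, add_zero] at h3
      exact hy hy0 (by nlinarith))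
    (by
      intro y hy
      have := hvle y (sphere_subset_closedBall hy)
      linarith)
    x₀ (by simp; positivity)
  rw [← hA] at hcmp
  simp only [sub_self, norm_zero] at hcmp
  have hv0 : 0 ≤ u x₀ + κ / 2 * T ^ 2 := by
    have m1 := mvt_ge (a := 0) (b := T) hT.le (line_hasDeriv hu.1 x₀ κ) (by
      intro r hr
      have := hκ (x₀ + (r - x₀ 0) • e1 m) (by rw [shift_coord]; linarith [hr.1])
      rw [shift_coord] at this
      have h2 : x₀ 0 + (r - x₀ 0) = r := by ring
      rwa [h2] at this)
    rw [(hcross x₀).1] at m1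
    rw [hTdef] at m1 ⊢
    simpa using m1
  have : 0 < A * T ^ 2 := by positivity
  nlinarith

lemma step2 {m : ℕ} {u : E (m + 2) → ℝ} (hu : C11 u) {K : ℝ≥0}
    (hK : LipschitzWith K (fderiv ℝ u))
    (hz : ∀ x : E (m + 2), x 0 ≤ 0 → u x = 0 ∧ D1 u x = 0)
    (hlap : ∀ᵐ x : E (m + 2), 0 < x 0 → D1 u x < 0 → lap u x = 1) :
    ∀ x : E (m + 2), 0 < x 0 → 0 ≤ D1 u x := by
  by_contra hcon
  push Not at hcon
  obtain ⟨x₁, hx₁, hD⟩ := hcon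
  set S : Set ℝ := {r | ∃ x : E (m + 2), 0 < x 0 ∧ r = - D1 u x / x 0} with hS
  have hSne : S.Nonempty := ⟨_, x₁, hx₁, rfl⟩
  have hSb : BddAbove S := by
    refine ⟨K, ?_⟩
    rintro r ⟨x, hx, rfl⟩
    rw [div_le_iff₀ hx]
    have h0 := (hz (x + (- x 0) • e1 m) (by rw [shift_coord]; linarith)).2
    have h3 := (abs_le.mp (D1_lip hK x (x + (- x 0) • e1 m))).1
    have h4 : x - (x + (- x 0) • e1 m) = x 0 • e1 m := by module
    rw [h4, h0, norm_smul, norm_e1, mul_one, Real.norm_eq_abs, abs_of_pos hx] at h3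
    linarith
  set κ := sSup S with hκ
  have hκle : ∀ x : E (m + 2), 0 < x 0 → 0 ≤ D1 u x + κ * x 0 := by
    intro x hx
    have h1 : - D1 u x / x 0 ≤ κ := le_csSup hSb ⟨x, hx, rfl⟩
    rw [div_le_iff₀ hx] at h1
    linarith
  have hκ0 : 0 < κ := by
    have := hκle x₁ hx₁
    by_contra hc
    push Not at hc
    nlinarith
  obtain ⟨η, hη, H⟩ := improve hu hK hz hlap hκ0 hκle
  have : κ ≤ κ - η := by
    refine csSup_le hSne ?_
    rintro r ⟨x, hx, rfl⟩
    rw [div_le_iff₀ hx]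
    have := H x hx
    linarith
  linarith

lemma extend_zero {m : ℕ} {g : E (m + 2) → ℝ} (hg : Continuous g)
    (h : ∀ x : E (m + 2), x 0 < 0 → g x = 0) : ∀ x : E (m + 2), x 0 ≤ 0 → g x = 0 := by
  intro x hx
  have h1 : Tendsto (fun t : ℝ => g (x + t • e1 m)) (nhdsWithin 0 (Iio 0)) (nhds (g x)) := by
    have hc : Continuous (fun t : ℝ => g (x + t • e1 m)) := by fun_prop
    have := hc.tendsto 0
    simp only [zero_smul, add_zero] at this
    exact this.mono_left nhdsWithin_le_nhds
  have h2 : Tendsto (fun t : ℝ => g (x + t • e1 m)) (nhdsWithin 0 (Iio 0)) (nhds 0) := by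
    refine tendsto_const_nhds.congr' ?_
    filter_upwards [self_mem_nhdsWithin] with t ht
    rw [h _ (by rw [shift_coord]; have : t < 0 := ht; linarith)]
  exact tendsto_nhds_unique h1 h2

/-- **Positivity of global solutions.** If `u ∈ P_∞(M)` with upper obstacle
`ψ(x) = (a/2)(x₁⁺)²` and `δ_r(u) ≥ ε₀ > 0` for all `r > 0`, then `u ≥ 0` everywhere and
`Δu = χ_{{0<u<ψ}} + a·χ_{{0<u=ψ}}` with `0 ≤ u ≤ ψ` almost everywhere. -/
theorem global_positivity (n : ℕ) (M a ε₀ : ℝ) (hε : 0 < ε₀)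
    (u ψ : E (n + 2) → ℝ)
    (hpsi : ψ = fun x => a / 2 * max (x 0) 0 ^ 2)
    (hP : Pinf (n + 2) M a u ψ)
    (hthick : ∀ r : ℝ, 0 < r → ε₀ ≤ thick univ u r) :
    (∀ x, 0 ≤ u x) ∧
    ∀ᵐ x : E (n + 2),
      lap u x = ({y | 0 < u y ∧ u y < ψ y}).indicator (fun _ => (1 : ℝ)) x
        + ({y | 0 < u y ∧ u y = ψ y}).indicator (fun _ => a) x ∧
      0 ≤ u x ∧ u x ≤ ψ x := by
  have hu : C11 u := ⟨hP.u_c1.differentiable one_ne_zero, _, hP.u_c11⟩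
  have hψ0 : ∀ x, 0 ≤ ψ x := by
    intro x; rw [hpsi]; have := hP.ha; simp only; positivity
  have hψmono : ∀ (x : E (n + 2)) (t : ℝ), t ≤ 0 → ψ (x + t • e1 n) ≤ ψ x := by
    intro x t ht
    have := hP.ha
    rw [hpsi]
    simp only [shift_coord]
    gcongr
    linarith
  have hle : ∀ x : E (n + 2), x 0 ≤ 0 → u x ≤ 0 := by
    intro x hx
    have := hP.u_le x
    rw [hpsi] at this
    simpa [max_eq_right hx] using this
  have hDψ : ∀ x, u x = ψ x → 0 ≤ D1 u x := by
    intro x hx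
    have hd := (line_deriv0 x (e1 n) (hu.1 x)).tendsto_slope_zero_left
    refine ge_of_tendsto hd ?_
    filter_upwards [self_mem_nhdsWithin] with t ht
    have ht' : t < 0 := ht
    have h1 := (hP.u_le (x + t • e1 n)).trans (hψmono x t ht'.le)
    simp only [zero_add, zero_smul, add_zero, smul_eq_mul]
    refine mul_nonneg_of_nonpos_of_nonpos (inv_nonpos.mpr ht'.le) ?_
    linarith
  have hlap1 : ∀ᵐ x : E (n + 2), u x < 0 → lap u x = 1 := by
    filter_upwards [hP.u_eq] with x hx hux
    have h1 : x ∈ Om univ u := ⟨mem_univ _, fun h => hux.ne h.2.1⟩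
    have h2 : u x < ψ x := hux.trans_le (hψ0 x)
    rw [hx, indicator_of_mem (show x ∈ Om univ u ∩ {y | u y < ψ y} from ⟨h1, h2⟩),
      indicator_of_notMem (fun h => h2.ne h.2)]
    simp
  have hgrad : ∀ x, gradient u x = 0 → fderiv ℝ u x = 0 := by
    intro x hx
    unfold gradient at hx
    simpa using hx
  have hlap2 : ∀ᵐ x : E (n + 2), 0 < x 0 → D1 u x < 0 → lap u x = 1 := by
    filter_upwards [hP.u_eq] with x hx _ hD
    have h1 : x ∈ Om univ u := by
      refine ⟨mem_univ _, fun h => ?_⟩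
      have := hgrad x h.2.2
      rw [D1, this] at hD
      simp at hD
    have h2 : u x < ψ x := lt_of_le_of_ne (hP.u_le x) (fun h => absurd (hDψ x h) (not_le.mpr hD))
    rw [hx, indicator_of_mem (show x ∈ Om univ u ∩ {y | u y < ψ y} from ⟨h1, h2⟩),
      indicator_of_notMem (fun h => h2.ne h.2)]
    simp
  have hs1 := step1 hu hle hlap1
  have hDc : Continuous (D1 u) := by
    unfold D1
    exact hP.u_c11.continuous.clm_apply continuous_const
  have hz : ∀ x : E (n + 2), x 0 ≤ 0 → u x = 0 ∧ D1 u x = 0 := by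
    intro x hx
    refine ⟨extend_zero hu.1.continuous hs1 x hx, extend_zero hDc ?_ x hx⟩
    intro y hy
    have hc : Continuous (fun x : E (n + 2) => x 0) := by fun_prop
    have hev : u =ᶠ[nhds y] fun _ => 0 := by
      filter_upwards [(isOpen_lt hc continuous_const).mem_nhds hy] with w hw using hs1 w hw
    rw [D1, hev.fderiv_eq]
    simp
  have hs2 := step2 hu hP.u_c11 hz hlap2
  have hpos : ∀ x, 0 ≤ u x := by
    intro x
    rcases le_or_gt (x 0) 0 with hx | hx
    · exact (hz x hx).1.ge
    have m1 := mvt_ge (a := 0) (b := x 0) hx.le (line_hasDeriv hu.1 x 0) (by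
      intro r hr
      have := hs2 (x + (r - x 0) • e1 n) (by rw [shift_coord]; linarith [hr.1])
      simpa using this)
    rw [(hz (x + (0 - x 0) • e1 n) (by rw [shift_coord]; linarith)).1] at m1
    simpa using m1
  refine ⟨hpos, ?_⟩
  have hOm : ∀ x, x ∈ Om univ u ↔ 0 < u x := by
    intro x
    constructor
    · intro h
      refine lt_of_le_of_ne (hpos x) fun h0 => h.2 ⟨mem_univ _, h0.symm, ?_⟩
      have hm : IsLocalMin u x := Eventually.of_forall fun y => by rw [← h0]; exact hpos y
      unfold gradient
      rw [hm.fderiv_eq_zero]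
      simp
    · intro h
      exact ⟨mem_univ _, fun h' => h.ne' h'.2.1⟩
  have e1' : Om univ u ∩ {y | u y < ψ y} = {y | 0 < u y ∧ u y < ψ y} := by
    ext x; exact and_congr (hOm x) Iff.rfl
  have e2' : Om univ u ∩ {y | u y = ψ y} = {y | 0 < u y ∧ u y = ψ y} := by
    ext x; exact and_congr (hOm x) Iff.rfl
  filter_upwards [hP.u_eq] with x hx
  rw [e1', e2'] at hx
  exact ⟨hx, hpos x, hP.u_le x⟩
end
end
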